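/- A finitely generated commutative (not necessarily unital) ring K is finitely separable if and only if there exists a squarefree natural number k such that K is a finite extension of its torsion ideal I_k and I_k is a subdirect product of a finite ring and a finite collection of rings without zero divisors, each of prime characteristic, in each of which any two transcendental elements are integrally dependent. -/

import Mathlib

/-- `nupow a n` represents the power `a ^ (n + 1)` in a (possibly non-unital) multiplicative
structure. -/
def nupow {K : Type*} [Mul K] (a : K) : ℕ → K
  | 0 => a
  | n + 1 => nupow a n * a

/-- Evaluation at `a ∈ K` of a one-variable polynomial over `ZMod p` with zero constant term;
coefficients act through their natural-number representatives (`ZMod.val`), which is the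
natural action on a ring of characteristic `p`. -/
noncomputable def pEval {p : ℕ} {K : Type*} [NonUnitalNonAssocRing K]
    (f : Polynomial (ZMod p)) (a : K) : K :=
  ∑ i ∈ f.support, (f.coeff i).val • (if i = 0 then 0 else nupow a (i - 1))

/-- Evaluation of the monomial `x ^ m 0 * y ^ m 1` at `(a, b)` (zero if `m = 0`). -/
noncomputable def monEval {K : Type*} [Mul K] [Zero K] (a b : K) (m : Fin 2 →₀ ℕ) : K :=
  if m 0 = 0 then (if m 1 = 0 then 0 else nupow b (m 1 - 1))
  else (if m 1 = 0 then nupow a (m 0 - 1) else nupow a (m 0 - 1) * nupow b (m 1 - 1))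

/-- Evaluation at `(a, b) ∈ K × K` of a two-variable polynomial over `ZMod p` with zero
constant term. -/
noncomputable def mvEval {p : ℕ} {K : Type*} [NonUnitalNonAssocRing K]
    (a b : K) (f : MvPolynomial (Fin 2) (ZMod p)) : K :=
  ∑ m ∈ f.support, (MvPolynomial.coeff m f).val • monEval a b m

/-- An element `a` of a ring of characteristic `p` is integral (algebraic over `Z_p`) if it is a
root of some nonzero polynomial over `Z_p` with zero constant term. -/
noncomputable def IsAlgebraicElt (p : ℕ) {K : Type*} [NonUnitalNonAssocRing K] (a : K) : Prop :=
  ∃ f : Polynomial (ZMod p), f ≠ 0 ∧ f.coeff 0 = 0 ∧ pEval f a = 0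

/-- An element is transcendental if it is not a root of any nonzero polynomial over `Z_p`
with zero constant term. -/
noncomputable def IsTranscendentalElt (p : ℕ) {K : Type*} [NonUnitalNonAssocRing K]
    (a : K) : Prop :=
  ∀ f : Polynomial (ZMod p), f ≠ 0 → f.coeff 0 = 0 → pEval f a ≠ 0

/-- A two-variable polynomial over `Z_p` is monic in the variable `i` if, viewed as a polynomial
in the variable `i`, its leading coefficient is `1`. -/
def MonicInVar {p : ℕ} (f : MvPolynomial (Fin 2) (ZMod p)) (i : Fin 2) : Prop :=
  MvPolynomial.coeff (Finsupp.single i (f.degreeOf i)) f = 1 ∧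
    ∀ m ∈ f.support, m i = f.degreeOf i → m = Finsupp.single i (f.degreeOf i)

/-- Two elements `a, b` of a ring of prime characteristic `p` are integrally dependent if
`f (a, b) = 0` for some polynomial `f ∈ Z_p[x, y]` with zero constant term that is monic as a
polynomial in `x` and monic as a polynomial in `y`. -/
noncomputable def IntegrallyDependent (p : ℕ) {K : Type*} [NonUnitalNonAssocRing K]
    (a b : K) : Prop :=
  ∃ f : MvPolynomial (Fin 2) (ZMod p), MvPolynomial.constantCoeff f = 0 ∧
    MonicInVar f 0 ∧ MonicInVar f 1 ∧ mvEval a b f = 0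

/-- A (not necessarily unital) ring `K` is finitely separable if every element `a ∉ A`, where
`A` is a (not necessarily unital) subring, can be separated from `A` by a homomorphism to a
finite ring. -/
def FinitelySeparable (K : Type*) [NonUnitalNonAssocRing K] : Prop :=
  ∀ (a : K) (A : NonUnitalSubring K), a ∉ A →
    ∃ (F : Type) (_ : NonUnitalRing F) (_ : Finite F) (φ : K →ₙ+* F),
      φ a ∉ φ '' (A : Set K)

/-- The `k`-torsion ideal `I_k = {a ∈ K : k • a = 0}` of `K`, as an additive subgroup. -/
def torsionAddSubgroup (K : Type*) [NonUnitalNonAssocRing K] (k : ℕ) : AddSubgroup K where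
  carrier := {a | k • a = 0}
  add_mem' := by
    intro a b ha hb
    simp only [Set.mem_setOf_eq, smul_add] at *
    rw [ha, hb, add_zero]
  zero_mem' := by simp
  neg_mem' := by
    intro a ha
    simp only [Set.mem_setOf_eq, smul_neg] at *
    rw [ha, neg_zero]

/-- The `k`-torsion ideal `I_k = {a ∈ K : k • a = 0}` of a commutative ring `K`, as a
non-unital subring (it is in fact an ideal). -/
def torsionSubring (K : Type*) [NonUnitalCommRing K] (k : ℕ) : NonUnitalSubring K where
  carrier := {a | k • a = 0}
  add_mem' := by
    intro a b ha hb
    simp only [Set.mem_setOf_eq, smul_add] at *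
    rw [ha, hb, add_zero]
  zero_mem' := by simp
  neg_mem' := by
    intro a ha
    simp only [Set.mem_setOf_eq, smul_neg] at *
    rw [ha, neg_zero]
  mul_mem' := by
    intro a b ha hb
    simp only [Set.mem_setOf_eq] at *
    rw [← smul_mul_assoc, ha, zero_mul]

namespace FinSep

/-! ### Finite covers of subsets modulo a subgroup -/

/-- `X` is covered by finitely many translates, by elements of `X`, of the set `Y`. -/
def CoveredMod {V : Type*} [AddCommGroup V] (X Y : Set V) : Prop :=
  ∃ T : Set V, T.Finite ∧ T ⊆ X ∧ ∀ x ∈ X, ∃ t ∈ T, x - t ∈ Y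

section CoveredMod

variable {V : Type*} [AddCommGroup V]

theorem coveredMod_of_map {γ : Type*} [Finite γ] {X Y : Set V} (g : V → γ)
    (h : ∀ x ∈ X, ∀ x' ∈ X, g x = g x' → x - x' ∈ Y) : CoveredMod X Y := by
  classical
  have : ∀ c : ↥(g '' X), ∃ x ∈ X, g x = c := fun c => c.2
  choose r hr hgr using this
  refine ⟨Set.range r, Set.finite_range r, ?_, ?_⟩
  · rintro _ ⟨c, rfl⟩
    exact hr c
  · intro x hx
    exact ⟨_, ⟨⟨g x, x, hx, rfl⟩, rfl⟩, h x hx _ (hr _) (hgr ⟨g x, x, hx, rfl⟩).symm⟩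

theorem coveredMod_of_finite {X : Set V} {Y : AddSubgroup V} {T : Set V} (hT : T.Finite)
    (h : ∀ x ∈ X, ∃ t ∈ T, x - t ∈ Y) : CoveredMod X (Y : Set V) := by
  classical
  by_cases hne : X.Nonempty
  · obtain ⟨x₀, hx₀⟩ := hne
    obtain ⟨t₀, ht₀, -⟩ := h x₀ hx₀
    have := hT.to_subtype
    choose! f hf hfY using h
    refine coveredMod_of_map (γ := ↥T) (fun x => if hx : x ∈ X then ⟨f x, hf x hx⟩ else ⟨t₀, ht₀⟩) ?_
    intro x hx x' hx' he
    simp only [hx, hx', dif_pos, Subtype.mk.injEq] at he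
    have := Y.sub_mem (hfY x hx) (hfY x' hx')
    rw [he] at this
    simpa using this
  · exact ⟨∅, Set.finite_empty, by simp, fun x hx => (hne ⟨x, hx⟩).elim⟩

theorem CoveredMod.mono {X Y Y' : Set V} (h : CoveredMod X Y) (hY : Y ⊆ Y') : CoveredMod X Y' := by
  obtain ⟨T, hT, hTX, h⟩ := h
  exact ⟨T, hT, hTX, fun x hx => (h x hx).imp fun t ht => ⟨ht.1, hY ht.2⟩⟩

theorem CoveredMod.subset {X X' : Set V} {Y : AddSubgroup V} (h : CoveredMod X (Y : Set V))
    (hX : X' ⊆ X) : CoveredMod X' (Y : Set V) := by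
  obtain ⟨T, hT, -, h⟩ := h
  exact coveredMod_of_finite hT fun x hx => h x (hX hx)

theorem CoveredMod.trans {X Y : Set V} {Z : AddSubgroup V} (h : CoveredMod X Y)
    (h' : CoveredMod Y (Z : Set V)) : CoveredMod X (Z : Set V) := by
  obtain ⟨T, hT, -, h⟩ := h
  obtain ⟨T', hT', -, h'⟩ := h'
  refine coveredMod_of_finite (T := Set.image2 (· + ·) T T') (hT.image2 _ hT') fun x hx => ?_
  obtain ⟨t, ht, hxt⟩ := h x hx
  obtain ⟨t', ht', hxt'⟩ := h' _ hxt
  exact ⟨t + t', ⟨t, ht, t', ht', rfl⟩, by rwa [← sub_sub]⟩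

theorem CoveredMod.inf {X : Set V} {Y Z : AddSubgroup V} (h : CoveredMod X (Y : Set V))
    (h' : CoveredMod X (Z : Set V)) : CoveredMod X ((Y ⊓ Z : AddSubgroup V) : Set V) := by
  classical
  obtain ⟨T, hT, -, h⟩ := h
  obtain ⟨T', hT', -, h'⟩ := h'
  have := hT.to_subtype
  have := hT'.to_subtype
  by_cases hne : X.Nonempty
  · obtain ⟨x₀, hx₀⟩ := hne
    obtain ⟨t₀, ht₀, -⟩ := h x₀ hx₀
    obtain ⟨t₀', ht₀', -⟩ := h' x₀ hx₀
    choose! f hf hfY using h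
    choose! f' hf' hfY' using h'
    refine coveredMod_of_map (γ := ↥T × ↥T') (fun x => if hx : x ∈ X then
      (⟨f x, hf x hx⟩, ⟨f' x, hf' x hx⟩) else (⟨t₀, ht₀⟩, ⟨t₀', ht₀'⟩)) ?_
    intro x hx x' hx' he
    simp only [hx, hx', dif_pos, Prod.mk.injEq, Subtype.mk.injEq] at he
    have h1 := Y.sub_mem (hfY x hx) (hfY x' hx')
    have h2 := Z.sub_mem (hfY' x hx) (hfY' x' hx')
    rw [he.1] at h1
    rw [he.2] at h2
    exact ⟨by simpa using h1, by simpa using h2⟩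
  · exact ⟨∅, Set.finite_empty, by simp, fun x hx => (hne ⟨x, hx⟩).elim⟩

theorem CoveredMod.iInf {ι : Type*} [Finite ι] {X : Set V} {Y : ι → AddSubgroup V}
    (h : ∀ i, CoveredMod X (Y i : Set V)) : CoveredMod X ((⨅ i, Y i : AddSubgroup V) : Set V) := by
  classical
  have := Fintype.ofFinite ι
  have key : ∀ s : Finset ι, CoveredMod X ((⨅ i ∈ s, Y i : AddSubgroup V) : Set V) := by
    intro s
    induction s using Finset.induction_on with
    | empty => exact coveredMod_of_map (γ := Unit) (fun _ => ()) (by simp)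
    | insert a s _ ih =>
      rw [Finset.iInf_insert]
      exact (h a).inf ih
  simpa using key Finset.univ

theorem CoveredMod.exists_sub_mem {X : Set V} {Y : AddSubgroup V} (h : CoveredMod X (Y : Set V))
    (f : ℕ → V) (hf : ∀ n, f n ∈ X) : ∃ i j, i < j ∧ f i - f j ∈ Y := by
  obtain ⟨T, hT, -, h⟩ := h
  choose! g hg hgY using h
  have := hT.to_subtype
  obtain ⟨i, j, hij, he⟩ := Finite.exists_ne_map_eq_of_infinite
    (fun n : ℕ => (⟨g (f n), hg _ (hf n)⟩ : ↥T))
  simp only [Subtype.mk.injEq] at he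
  have key : f i - f j ∈ Y := by
    have := Y.sub_mem (hgY _ (hf i)) (hgY _ (hf j))
    rw [he] at this
    simpa using this
  rcases lt_or_gt_of_ne hij with h' | h'
  · exact ⟨i, j, h', key⟩
  · exact ⟨j, i, h', by simpa using Y.neg_mem key⟩

theorem coveredMod_of_finite_quotient {R M : Type*} [CommRing R] [AddCommGroup M] [Module R M]
    (J : Submodule R M) [Finite (M ⧸ J)] (X : Set M) : CoveredMod X (J : Set M) :=
  coveredMod_of_map (Submodule.Quotient.mk (p := J)) fun _ _ _ _ he =>
    (Submodule.Quotient.eq J).1 he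

theorem CoveredMod.finite_of_bot {X : Set V} (h : CoveredMod X {0}) : X.Finite := by
  obtain ⟨T, hT, -, h⟩ := h
  refine hT.subset fun x hx => ?_
  obtain ⟨t, ht, hxt⟩ := h x hx
  rw [Set.mem_singleton_iff, sub_eq_zero] at hxt
  rwa [hxt]

end CoveredMod

/-! ### Residual finiteness -/

theorem isJacobsonRing_int : IsJacobsonRing ℤ := by
  rw [isJacobsonRing_iff_prime_eq]
  intro P hP
  by_cases h : P = ⊥
  · subst h
    rw [eq_bot_iff]
    intro n hn
    have := Ideal.mem_jacobson_bot.1 hn n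
    rw [Int.isUnit_iff] at this
    rcases this with h | h
    · have h0 : n * n = 0 := by linarith
      simpa using h0
    · nlinarith [mul_self_nonneg n]
  · exact Ideal.jacobson_eq_self_of_isMaximal (H := hP.isMaximal h)

theorem finite_quotient_of_isMaximal {R : Type*} [CommRing R] [Algebra.FiniteType ℤ R]
    (m : Ideal R) [m.IsMaximal] : Finite (R ⧸ m) := by
  let := Ideal.Quotient.field m
  have : Algebra.FiniteType ℤ (R ⧸ m) :=
    Algebra.FiniteType.of_surjective (Ideal.Quotient.mkₐ ℤ m) Ideal.Quotient.mk_surjective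
  have := isJacobsonRing_int
  have hfin : Module.Finite ℤ (R ⧸ m) := finite_of_finite_type_of_isJacobsonRing ℤ (R ⧸ m)
  have h_int : Algebra.IsIntegral ℤ (R ⧸ m) := Algebra.IsIntegral.of_finite ℤ (R ⧸ m)
  obtain ⟨p, hp⟩ := CharP.exists (R ⧸ m)
  rcases CharP.char_is_prime_or_zero (R ⧸ m) p with hpp | rfl
  · have : Fact p.Prime := ⟨hpp⟩
    let := ZMod.algebra (R ⧸ m) p
    have : Module.Finite (ZMod p) (R ⧸ m) := Module.Finite.of_restrictScalars_finite ℤ (ZMod p) (R ⧸ m)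
    exact Module.finite_of_finite (ZMod p)
  · exfalso
    have : CharZero (R ⧸ m) := CharP.charP_to_charZero _
    exact Int.not_isField
      (isField_of_isIntegral_of_isField (R := ℤ) (S := R ⧸ m) Int.cast_injective
        (Field.toIsField _))

theorem exists_finite_quotient_notMem {R M : Type*} [CommRing R] [Algebra.FiniteType ℤ R]
    [AddCommGroup M] [Module R M] [Module.Finite R M] {x : M} (hx : x ≠ 0) :
    ∃ N : Submodule R M, Finite (M ⧸ N) ∧ x ∉ N := by
  have : IsNoetherianRing R := Algebra.FiniteType.isNoetherianRing ℤ R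
  have hne : Ideal.torsionOf R M x ≠ ⊤ := by
    simpa [Ideal.torsionOf_eq_top_iff] using hx
  obtain ⟨m, hm, hle⟩ := Ideal.exists_le_maximal _ hne
  have hnot : x ∉ ⨅ i : ℕ, m ^ i • (⊤ : Submodule R M) := by
    rw [Ideal.mem_iInf_smul_pow_eq_bot_iff]
    rintro ⟨r, hr⟩
    have h1 : 1 - (r : R) ∈ m := hle (by simp [Ideal.mem_torsionOf_iff, sub_smul, hr])
    exact hm.ne_top ((Ideal.eq_top_iff_one _).2 (by simpa using m.add_mem h1 r.2))
  simp only [Submodule.mem_iInf, not_forall] at hnot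
  obtain ⟨n, hn⟩ := hnot
  have := finite_quotient_of_isMaximal m
  have : Finite (R ⧸ m ^ n) := Ideal.finite_quotient_pow (IsNoetherian.noetherian m) n
  exact ⟨m ^ n • ⊤, Submodule.finite_quotient_smul (m ^ n) Module.Finite.fg_top, hn⟩

theorem exists_finite_quotient_of_notMem {R M : Type*} [CommRing R] [Algebra.FiniteType ℤ R]
    [AddCommGroup M] [Module R M] [Module.Finite R M] {N : Submodule R M} {x : M} (hx : x ∉ N) :
    ∃ N' : Submodule R M, N ≤ N' ∧ Finite (M ⧸ N') ∧ x ∉ N' := by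
  have hx' : N.mkQ x ≠ 0 := by simpa [Submodule.Quotient.mk_eq_zero] using hx
  obtain ⟨L, hL, hxL⟩ := exists_finite_quotient_notMem (R := R) hx'
  refine ⟨L.comap N.mkQ, ?_, ?_, hxL⟩
  · intro y hy
    have : N.mkQ y = 0 := by simpa [Submodule.Quotient.mk_eq_zero] using hy
    simp [Submodule.mem_comap, this]
  · have hinj : Function.Injective (Submodule.mapQ (L.comap N.mkQ) L N.mkQ le_rfl) := by
      rw [← LinearMap.ker_eq_bot, Submodule.ker_mapQ]
      simp
    exact Finite.of_injective _ hinj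

/-! ### The unitization of a non-unital ring -/

section Dorroh

variable {B K : Type*} [CommRing B] [NonUnitalCommRing K] [Module B K] [IsScalarTower B K K]
  [SMulCommClass B K K]

/-- The Dorroh extension `B × K` of a non-unital `B`-algebra `K`, as a type with its own
instances. -/
def Dorroh (B K : Type*) : Type _ := Unitization B K

namespace Dorroh

noncomputable instance : CommRing (Dorroh B K) := inferInstanceAs (CommRing (Unitization B K))

noncomputable instance : Algebra B (Dorroh B K) :=
  inferInstanceAs (Algebra B (Unitization B K))

/-- The projection onto the base ring. -/
noncomputable def fst : Dorroh B K →ₐ[B] B := Unitization.fstHom B K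

/-- The projection onto the non-unital ring. -/
noncomputable def snd : Dorroh B K →+ K where
  toFun := fun u : Unitization B K => u.toProd.2
  map_zero' := rfl
  map_add' _ _ := rfl

/-- The inclusion of the non-unital ring. -/
noncomputable def inr : K →ₙ+* Dorroh B K where
  toFun := Unitization.inr
  map_mul' := Unitization.inr_mul B
  map_add' := Unitization.inr_add B
  map_zero' := Unitization.inr_zero B

@[simp]
theorem fst_inr (x : K) : fst (inr x : Dorroh B K) = 0 := rfl

@[simp]
theorem snd_inr (x : K) : snd (inr x : Dorroh B K) = x := rfl

@[simp]
theorem fst_algebraMap (b : B) : fst (algebraMap B (Dorroh B K) b) = b := rfl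

@[simp]
theorem snd_algebraMap (b : B) : snd (algebraMap B (Dorroh B K) b) = 0 := rfl

theorem snd_mul (u v : Dorroh B K) :
    snd (u * v) = fst u • snd v + fst v • snd u + snd u * snd v := Unitization.snd_mul u v

theorem algebraMap_fst_add_inr_snd (u : Dorroh B K) :
    algebraMap B (Dorroh B K) (fst u) + inr (snd u) = u :=
  Unitization.inl_fst_add_inr_snd_eq u

theorem inr_injective : Function.Injective (inr : K → Dorroh B K) := Unitization.inr_injective

/-- The homomorphism from the Dorroh extension extending a homomorphism to a unital ring. -/
noncomputable def lift {C : Type*} [CommRing C] [Algebra B C]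
    (hB : Function.Surjective (Int.cast : ℤ → B)) (f : K →ₙ+* C) : Dorroh B K →ₐ[B] C :=
  Unitization.lift (A := K) { f with
    map_smul' := fun b x => by
      obtain ⟨n, rfl⟩ := hB b
      have := map_zsmul f n x
      rw [Int.cast_smul_eq_zsmul]
      exact this.trans (by simp [Algebra.smul_def]) }

@[simp]
theorem lift_inr {C : Type*} [CommRing C] [Algebra B C]
    (hB : Function.Surjective (Int.cast : ℤ → B)) (f : K →ₙ+* C) (x : K) :
    lift hB f (inr x) = f x :=
  DFunLike.congr_fun (Unitization.lift.symm_apply_apply _) x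

end Dorroh

theorem adjoin_inr_eq_top {s : Set K} (hs : NonUnitalSubring.closure s = ⊤) :
    Algebra.adjoin B ((Dorroh.inr : K → Dorroh B K) '' s) = ⊤ := by
  rw [eq_top_iff]
  rintro u -
  rw [← Dorroh.algebraMap_fst_add_inr_snd u]
  refine Subalgebra.add_mem _ (Subalgebra.algebraMap_mem _ _) ?_
  have hu : Dorroh.snd u ∈ NonUnitalSubring.closure s := hs ▸ NonUnitalSubring.mem_top _
  generalize Dorroh.snd u = v at hu ⊢
  induction hu using NonUnitalSubring.closure_induction with
  | mem x hx => exact Algebra.subset_adjoin ⟨x, hx, rfl⟩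
  | zero => simp
  | add x y _ _ hx hy => simpa using Subalgebra.add_mem _ hx hy
  | neg x _ hx => simpa using Subalgebra.neg_mem _ hx
  | mul x y _ _ hx hy => simpa using Subalgebra.mul_mem _ hx hy

theorem finiteType_dorroh (hfg : ∃ S : Finset K, NonUnitalSubring.closure (S : Set K) = ⊤) :
    Algebra.FiniteType B (Dorroh B K) := by
  classical
  obtain ⟨S, hS⟩ := hfg
  refine ⟨⟨S.image Dorroh.inr, ?_⟩⟩
  rw [Finset.coe_image]
  exact adjoin_inr_eq_top hS

theorem countable_of_finiteType (B : Type*) {U : Type*} [CommRing B] [Countable B] [CommRing U]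
    [Algebra B U] [Algebra.FiniteType B U] : Countable U := by
  obtain ⟨n, f, hf⟩ := Algebra.FiniteType.iff_quotient_mvPolynomial''.1
    (inferInstance : Algebra.FiniteType B U)
  have : Countable (MvPolynomial (Fin n) B) :=
    (AddMonoidAlgebra.coeffEquiv (R := B) (M := Fin n →₀ ℕ)).injective.countable
  exact hf.countable

theorem countable_ideal {U : Type*} [CommRing U] [IsNoetherianRing U] [Countable U] :
    Countable (Ideal U) := by
  have : Function.Surjective fun s : Finset U => Ideal.span (s : Set U) := fun I => by
    obtain ⟨s, hs⟩ := IsNoetherian.noetherian I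
    exact ⟨s, hs⟩
  exact this.countable

end Dorroh

theorem CoveredMod.finite_quotient {R : Type*} [CommRing R] {J : Ideal R}
    (h : CoveredMod Set.univ (J : Set R)) : Finite (R ⧸ J) := by
  obtain ⟨T, hT, -, h⟩ := h
  have := hT.to_subtype
  refine Finite.of_surjective (fun t : ↥T => Ideal.Quotient.mk J t) fun y => ?_
  obtain ⟨x, rfl⟩ := Ideal.Quotient.mk_surjective y
  obtain ⟨t, ht, hxt⟩ := h x trivial
  exact ⟨⟨t, ht⟩, (Ideal.Quotient.eq.2 hxt).symm⟩

section Separation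

variable {B K : Type*} [CommRing B] [NonUnitalCommRing K] [Module B K] [IsScalarTower B K K]
  [SMulCommClass B K K]

theorem exists_ideal_of_finitelySeparable (hB : Function.Surjective (Int.cast : ℤ → B))
    (hK : FinitelySeparable K) {A : NonUnitalSubring K} {a : K} (ha : a ∉ A) :
    ∃ J : Ideal (Dorroh B K), Finite (Dorroh B K ⧸ J) ∧
      ∀ x ∈ A, (Dorroh.inr (a - x) : Dorroh B K) ∉ J := by
  obtain ⟨F, _, _, φ, hφ⟩ := hK a A ha
  have hn0 : Nat.card F ≠ 0 := Nat.card_pos.ne'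
  have hcard : ∀ y : F, (Nat.card F) • y = 0 := fun y => card_nsmul_eq_zero'
  have hsmul : ∀ (b : B) (x : K), φ x = 0 → φ (b • x) = 0 := fun b x hx => by
    obtain ⟨z, rfl⟩ := hB b
    rw [Int.cast_smul_eq_zsmul, map_zsmul, hx, smul_zero]
  have hnsmul : ∀ (b : B) (x : K), φ (((Nat.card F : B) * b) • x) = 0 := fun b x => by
    rw [mul_smul, Nat.cast_smul_eq_nsmul, map_nsmul, hcard]
  let J : Ideal (Dorroh B K) :=
    { carrier := {u | φ (Dorroh.snd u) = 0 ∧ ∃ b, Dorroh.fst u = Nat.card F * b}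
      add_mem' := by
        rintro u v ⟨hu, b, hb⟩ ⟨hv, c, hc⟩
        exact ⟨by simp [hu, hv], b + c, by simp [hb, hc, mul_add]⟩
      zero_mem' := ⟨by simp, 0, by simp⟩
      smul_mem' := by
        rintro c u ⟨hu, b, hb⟩
        refine ⟨?_, Dorroh.fst c * b, by simp [hb]; ring⟩
        simp only [smul_eq_mul, Dorroh.snd_mul, map_add, map_mul, hu, mul_zero, add_zero]
        rw [hsmul _ _ hu, hb, hnsmul, add_zero] }
  refine ⟨J, ?_, ?_⟩
  · apply CoveredMod.finite_quotient
    choose z hz using hB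
    have : NeZero (Nat.card F) := ⟨hn0⟩
    refine coveredMod_of_map (γ := F × ZMod (Nat.card F))
      (fun u => (φ (Dorroh.snd u), (z (Dorroh.fst u) : ZMod (Nat.card F)))) ?_
    rintro u - v - he
    simp only [Prod.mk.injEq] at he
    refine ⟨by simp [sub_eq_add_neg, he.1], ?_⟩
    obtain ⟨w, hw⟩ := (ZMod.intCast_eq_intCast_iff_dvd_sub _ _ _).1 he.2.symm
    refine ⟨w, ?_⟩
    have := congrArg (Int.cast : ℤ → B) hw
    push_cast at this
    rw [hz, hz] at this
    simpa [sub_eq_add_neg] using this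
  · rintro x hx ⟨h, -⟩
    rw [Dorroh.snd_inr, map_sub, sub_eq_zero] at h
    exact hφ ⟨x, hx, h.symm⟩

/-- The ring `K` viewed inside its unitization. -/
noncomputable abbrev inrRange (B K : Type*) [CommRing B] [NonUnitalCommRing K] [Module B K] [IsScalarTower B K K]
  [SMulCommClass B K K] : Ideal (Dorroh B K) := RingHom.ker (Dorroh.fst (B := B) (K := K))

theorem mem_inrRange {u : Dorroh B K} : u ∈ inrRange B K ↔ Dorroh.fst u = 0 := Iff.rfl

theorem inr_mem_inrRange (x : K) : (Dorroh.inr x : Dorroh B K) ∈ inrRange B K := by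
  simp

theorem exists_inr_of_mem {u : Dorroh B K} (hu : u ∈ inrRange B K) :
    (Dorroh.inr (Dorroh.snd u) : Dorroh B K) = u := by
  conv_rhs => rw [← Dorroh.algebraMap_fst_add_inr_snd u, mem_inrRange.1 hu]
  simp

theorem uncountable_dual {F W : Type*} [Field F] [Finite F] [AddCommGroup W] [Module F W]
    [Infinite W] : Uncountable (W →+ F) := by
  let b := Module.Basis.ofVectorSpace F W
  have hι : Infinite (Module.Basis.ofVectorSpaceIndex F W) := by
    by_contra h
    rw [not_infinite_iff_finite] at h
    have : Module.Finite F W := Module.Finite.of_basis b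
    have : Finite W := Module.finite_of_finite F
    exact not_finite W
  let e := (b.constr (M' := F) ℕ).toEquiv
  rw [← not_countable_iff]
  intro hc
  have : Countable (W →ₗ[F] F) :=
    (LinearMap.toAddMonoidHom_injective (R := F) (M := W) (M₃ := F)).countable
  have : Countable (Module.Basis.ofVectorSpaceIndex F W → F) := e.injective.countable
  have h2 : Function.Injective fun (s : Set ℕ) (i : Module.Basis.ofVectorSpaceIndex F W) =>
      open Classical in
      if ∃ n, n ∈ s ∧ Infinite.natEmbedding _ n = i then (1 : F) else 0 := by
    intro s t hst
    ext n
    have := congrFun hst (Infinite.natEmbedding _ n)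
    simp only [EmbeddingLike.apply_eq_iff_eq, exists_eq_right] at this
    by_cases h1 : n ∈ s <;> by_cases h2 : n ∈ t <;> simp_all
  have : Countable (Set ℕ) := h2.countable
  obtain ⟨f, hf⟩ := exists_surjective_nat (Set ℕ)
  exact Function.cantor_surjective f hf

theorem uncountable_dual_zmod {p : ℕ} [Fact p.Prime] {W : Type*} [AddCommGroup W]
    (hW : ∀ w : W, p • w = 0) [Infinite W] : Uncountable (W →+ ZMod p) :=
  let : Module (ZMod p) W := AddCommGroup.zmodModule hW
  uncountable_dual

theorem coveredMod_ideal_sq [Countable (Ideal (Dorroh B K))]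
    (hB : Function.Surjective (Int.cast : ℤ → B)) (hK : FinitelySeparable K)
    {L : Ideal (Dorroh B K)} (hL : L ≤ inrRange B K) {p : ℕ} (hp : p.Prime) :
    CoveredMod (L : Set (Dorroh B K))
      ((L * L ⊔ Ideal.span {(p : Dorroh B K)} * L : Ideal (Dorroh B K)) : Set _) := by
  have := Fact.mk hp
  set M : Ideal (Dorroh B K) := L * L ⊔ Ideal.span {(p : Dorroh B K)} * L with hM
  let M' : AddSubgroup L := (M.toAddSubgroup).comap L.toAddSubgroup.subtype
  let mk : L →+ L ⧸ M' := QuotientAddGroup.mk' M'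
  have hmk : ∀ x : L, mk x = 0 ↔ (x : Dorroh B K) ∈ M := fun x =>
    QuotientAddGroup.eq_zero_iff (N := M') x
  have hpW : ∀ w : L ⧸ M', p • w = 0 := by
    intro w
    obtain ⟨x, rfl⟩ := QuotientAddGroup.mk'_surjective M' w
    change p • mk x = 0
    rw [← map_nsmul, hmk]
    refine Ideal.mem_sup_right ?_
    have := Ideal.mul_mem_mul (Ideal.mem_span_singleton_self (p : Dorroh B K)) x.2
    simpa [nsmul_eq_mul] using this
  rcases finite_or_infinite (L ⧸ M') with hfin | hinf
  · refine coveredMod_of_map (γ := L ⧸ M') (fun u => open Classical in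
      if hu : u ∈ L then mk ⟨u, hu⟩ else 0) ?_
    intro x hx x' hx' he
    simp only [SetLike.mem_coe] at hx hx'
    simp only [hx, hx', dif_pos] at he
    rw [← sub_eq_zero, ← map_sub, hmk] at he
    exact he
  exfalso
  have hunc : Uncountable ((L ⧸ M') →+ ZMod p) := uncountable_dual_zmod hpW
  let S : Ideal (Dorroh B K) → Set ((L ⧸ M') →+ ZMod p) := fun J =>
    {l | Finite (Dorroh B K ⧸ J) ∧ ∀ x : L, (x : Dorroh B K) ∈ J → l (mk x) = 0}
  have hS : ∀ J, (S J).Countable := by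
    intro J
    by_cases hJ : Finite (Dorroh B K ⧸ J)
    swap
    · convert Set.countable_empty
      ext l
      simp [S, hJ]
    obtain ⟨T, hT, hTL, hcov⟩ := coveredMod_of_finite_quotient J (L : Set (Dorroh B K))
    have := hT.to_subtype
    have hinj : Function.Injective fun (l : S J) (t : ↥T) => (l : (L ⧸ M') →+ ZMod p) (mk ⟨t, hTL t.2⟩) := by
      rintro ⟨l, hl⟩ ⟨l', hl'⟩ he
      simp only [Subtype.mk.injEq]
      ext x
      obtain ⟨t, ht, hxt⟩ := hcov x x.2
      have h1 := hl.2 (x - ⟨t, hTL ht⟩) hxt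
      have h2 := hl'.2 (x - ⟨t, hTL ht⟩) hxt
      rw [map_sub, map_sub, sub_eq_zero] at h1 h2
      change l (mk x) = l' (mk x)
      rw [h1, h2]
      exact congrFun he ⟨t, ht⟩
    have : Finite (S J) := Finite.of_injective _ hinj
    exact Set.to_countable _
  have hcover : (Set.univ : Set ((L ⧸ M') →+ ZMod p)) ⊆ ⋃ J, S J := by
    rintro l -
    rw [Set.mem_iUnion]
    let A : NonUnitalSubring K :=
      { carrier := {x | ∃ h : (Dorroh.inr x : Dorroh B K) ∈ L, l (mk ⟨_, h⟩) = 0}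
        add_mem' := by
          rintro x y ⟨hx, hx'⟩ ⟨hy, hy'⟩
          refine ⟨by simpa using L.add_mem hx hy, ?_⟩
          have : (⟨Dorroh.inr (x + y), by simpa using L.add_mem hx hy⟩ : L) =
            ⟨_, hx⟩ + ⟨_, hy⟩ := by ext1; simp
          rw [this, map_add, map_add, hx', hy', add_zero]
        zero_mem' := by
          refine ⟨by simp, ?_⟩
          have : (⟨Dorroh.inr (0 : K), by simp⟩ : L) = 0 := by ext1; simp
          rw [this, map_zero, map_zero]
        neg_mem' := by
          rintro x ⟨hx, hx'⟩
          refine ⟨by simpa using hx, ?_⟩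
          have : (⟨Dorroh.inr (-x), by simpa using hx⟩ : L) = - ⟨_, hx⟩ := by ext1; simp
          rw [this, map_neg, map_neg, hx', neg_zero]
        mul_mem' := by
          rintro x y ⟨hx, hx'⟩ ⟨hy, hy'⟩
          refine ⟨by simpa using L.mul_mem_left _ hy, ?_⟩
          have : mk ⟨Dorroh.inr (x * y), by simpa using L.mul_mem_left _ hy⟩ = 0 := by
            rw [hmk]
            have : (Dorroh.inr x * Dorroh.inr y : Dorroh B K) ∈ M :=
              Submodule.mem_sup_left (Ideal.mul_mem_mul hx hy)
            rwa [← map_mul] at this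
          rw [this, map_zero] }
    by_cases hl : ∃ x : L, l (mk x) ≠ 0
    · obtain ⟨x, hx⟩ := hl
      have hxK := exists_inr_of_mem (hL x.2)
      have ha : Dorroh.snd (x : Dorroh B K) ∉ A := by
        rintro ⟨h, h'⟩
        apply hx
        rw [← h']
        congr 2
        exact Subtype.ext hxK.symm
      obtain ⟨J, hJ, hJA⟩ := exists_ideal_of_finitelySeparable hB hK ha
      refine ⟨J, hJ, fun y hy => ?_⟩
      by_contra hne
      let c : ZMod p := l (mk x) / l (mk y)
      let y' : L := x - c.val • y
      have hy' : l (mk y') = 0 := by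
        simp only [y', map_sub, map_nsmul]
        rw [nsmul_eq_mul, ZMod.natCast_zmod_val, div_mul_cancel₀ _ hne, sub_self]
      have hyK := exists_inr_of_mem (hL y'.2)
      refine hJA (Dorroh.snd (y' : Dorroh B K)) ⟨by rw [hyK]; exact y'.2, ?_⟩ ?_
      · rw [← hy']
        congr 2
        exact Subtype.ext hyK
      · rw [map_sub, hxK, hyK]
        simp only [y', Submodule.coe_sub, Submodule.coe_smul_of_tower, sub_sub_cancel]
        exact nsmul_mem hy _
    · push Not at hl
      refine ⟨⊤, inferInstance, fun x _ => hl x⟩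
  exact Set.not_countable_univ ((Set.countable_iUnion hS).mono hcover)

end Separation

open Polynomial in
theorem isIntegral_of_pow_sub_pow {S U : Type*} [CommRing S] [CommRing U] [Algebra S U] {u : U}
    {i j : ℕ} (hij : i < j) (h : IsIntegral S (u ^ i - u ^ j)) : IsIntegral S u := by
  nontriviality S
  have hd : (-(X ^ i) : S[X]).degree < (j : ℕ) := by
    rw [degree_neg, degree_X_pow]
    exact_mod_cast hij
  have hmon : (X ^ j + -(X ^ i) : S[X]).Monic := monic_X_pow_add hd
  refine IsIntegral.of_aeval_monic hmon ?_ ?_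
  · rw [natDegree_add_eq_left_of_degree_lt (by rwa [degree_X_pow]), natDegree_X_pow]
    omega
  · have := h.neg
    simpa [← sub_eq_add_neg] using this

section Integrality

variable {B K : Type*} [CommRing B] [NonUnitalCommRing K] [Module B K] [IsScalarTower B K K]
  [SMulCommClass B K K]

theorem coveredMod_mul_of_finitelySeparable [Countable (Ideal (Dorroh B K))]
    (hB : Function.Surjective (Int.cast : ℤ → B)) (hK : FinitelySeparable K)
    {p : ℕ} (hp : p.Prime) (c : Dorroh B K)
    (hreg : ∀ u ∈ inrRange B K, c * u = 0 → u = 0)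
    (hpc : ∀ u ∈ inrRange B K, ∃ v ∈ inrRange B K, (p : Dorroh B K) * (c * u) = c * (c * v)) :
    CoveredMod (inrRange B K : Set (Dorroh B K))
      ((Ideal.span {c} * inrRange B K : Ideal (Dorroh B K)) : Set (Dorroh B K)) := by
  obtain ⟨T, hT, hTL, h⟩ := coveredMod_ideal_sq hB hK
    (L := Ideal.span {c} * inrRange B K) Ideal.mul_le_right hp
  have hM : (Ideal.span {c} * inrRange B K) * (Ideal.span {c} * inrRange B K) ⊔
      Ideal.span {(p : Dorroh B K)} * (Ideal.span {c} * inrRange B K) ≤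
      Ideal.span {c} * (Ideal.span {c} * inrRange B K) := by
    refine sup_le ?_ ?_
    · rw [mul_assoc]
      refine Ideal.mul_mono_right ?_
      rw [mul_left_comm]
      exact Ideal.mul_mono_right Ideal.mul_le_right
    · intro x hx
      obtain ⟨y, hy, rfl⟩ := Ideal.mem_span_singleton_mul.1 hx
      obtain ⟨u, hu, rfl⟩ := Ideal.mem_span_singleton_mul.1 hy
      obtain ⟨v, hv, he⟩ := hpc u hu
      rw [he]
      exact Ideal.mem_span_singleton_mul.2 ⟨_, Ideal.mem_span_singleton_mul.2 ⟨v, hv, rfl⟩, rfl⟩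
  have hex : ∀ t ∈ T, ∃ z ∈ inrRange B K, c * z = t := fun t ht =>
    Ideal.mem_span_singleton_mul.1 (hTL ht)
  choose! g hg hgc using hex
  refine ⟨g '' T, hT.image g, by rintro _ ⟨t, ht, rfl⟩; exact hg t ht, fun x hx => ?_⟩
  obtain ⟨t, ht, hxt⟩ := h (c * x) (Ideal.mem_span_singleton_mul.2 ⟨x, hx, rfl⟩)
  refine ⟨g t, ⟨t, ht, rfl⟩, ?_⟩
  obtain ⟨y, hy, he⟩ := Ideal.mem_span_singleton_mul.1 (hM hxt)
  obtain ⟨u, hu, rfl⟩ := Ideal.mem_span_singleton_mul.1 hy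
  have h0 : x - g t - c * u = 0 := by
    refine hreg _ (Ideal.sub_mem _ (Ideal.sub_mem _ hx (hg t ht)) (Ideal.mul_mem_left _ _ hu)) ?_
    rw [mul_sub, mul_sub, hgc t ht, he, sub_self]
  rw [sub_eq_zero] at h0
  exact h0 ▸ hy

theorem isIntegral_of_finitelySeparable {S : Type*} [CommRing S] [Algebra S (Dorroh B K)]
    (hB : Function.Surjective (Int.cast : ℤ → B)) (hK : FinitelySeparable K) (s : S)
    (h1 : CoveredMod (inrRange B K : Set (Dorroh B K))
      ((Ideal.span {algebraMap S (Dorroh B K) s} * inrRange B K :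
        Ideal (Dorroh B K)) : Set (Dorroh B K)))
    (h2 : ∀ u ∈ inrRange B K, ∃ N, IsIntegral S (algebraMap S (Dorroh B K) s ^ N * u)) :
    ∀ u ∈ inrRange B K, IsIntegral S u := by
  set c := algebraMap S (Dorroh B K) s with hc
  have hcint : ∀ n, IsIntegral S (c ^ n) := fun n => by
    rw [hc, ← map_pow]; exact isIntegral_algebraMap
  have hmono : ∀ {m n : ℕ} {u : Dorroh B K}, m ≤ n → IsIntegral S (c ^ m * u) →
      IsIntegral S (c ^ n * u) := by
    intro m n u hmn hu
    obtain ⟨d, rfl⟩ := Nat.exists_eq_add_of_le' hmn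
    rw [pow_add, mul_assoc]
    exact (hcint d).mul hu
  have hfin : ∀ T : Set (Dorroh B K), T.Finite → T ⊆ inrRange B K →
      ∃ N, ∀ t ∈ T, IsIntegral S (c ^ N * t) := by
    intro T hT hTκ
    choose! f hf using h2
    obtain ⟨N, hN⟩ := (hT.image f).bddAbove
    exact ⟨N, fun t ht => hmono (hN ⟨t, ht, rfl⟩) (hf t (hTκ ht))⟩
  obtain ⟨T, hT, hTκ, hcov⟩ := id h1
  obtain ⟨k, hk⟩ := hfin T hT hTκ
  have claim1 : ∀ j, ∀ r ∈ inrRange B K, ∃ r' ∈ inrRange B K,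
      IsIntegral S (c ^ k * r - c ^ (k + j) * r') := by
    intro j
    induction j with
    | zero => exact fun r hr => ⟨r, hr, by simpa using isIntegral_zero⟩
    | succ j ih =>
      intro r hr
      obtain ⟨r', hr', hi⟩ := ih r hr
      obtain ⟨t, ht, hrt⟩ := hcov r' hr'
      obtain ⟨r'', hr'', he⟩ := Ideal.mem_span_singleton_mul.1 hrt
      refine ⟨r'', hr'', ?_⟩
      have := hi.add (hmono (Nat.le_add_right k j) (hk t ht))
      convert this using 1
      rw [← add_assoc, pow_succ, mul_assoc, he]
      ring
  have claim2 : ∀ r ∈ inrRange B K, IsIntegral S (c ^ k * r) := by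
    intro r hr
    by_contra hnot
    let A : NonUnitalSubring K :=
      { carrier := {x | IsIntegral S (Dorroh.inr x : Dorroh B K)}
        add_mem' := fun {x y} hx hy => by simpa using IsIntegral.add hx hy
        zero_mem' := by simpa using isIntegral_zero
        neg_mem' := fun {x} hx => by simpa using IsIntegral.neg hx
        mul_mem' := fun {x y} hx hy => by simpa using IsIntegral.mul hx hy }
    have hrκ := exists_inr_of_mem (Ideal.mul_mem_left _ (c ^ k) hr)
    have ha : Dorroh.snd (c ^ k * r) ∉ A := fun h => hnot (by rw [← hrκ]; exact h)
    obtain ⟨J, hJ, hJA⟩ := exists_ideal_of_finitelySeparable hB hK ha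
    obtain ⟨T', hT', hTκ', hcov'⟩ :=
      coveredMod_of_finite_quotient J (inrRange B K : Set (Dorroh B K))
    obtain ⟨M, hM⟩ := hfin T' hT' hTκ'
    obtain ⟨r', hr', hi⟩ := claim1 M r hr
    obtain ⟨t, ht, hrt⟩ := hcov' r' hr'
    have hx := hi.add (hmono (Nat.le_add_left M k) (hM t ht))
    have hxκ : c ^ k * r - c ^ (k + M) * r' + c ^ (k + M) * t ∈ inrRange B K :=
      Ideal.add_mem _ (Ideal.sub_mem _ (Ideal.mul_mem_left _ _ hr) (Ideal.mul_mem_left _ _ hr'))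
        (Ideal.mul_mem_left _ _ (hTκ' ht))
    have hxr := exists_inr_of_mem hxκ
    refine hJA _ (show _ ∈ A from hxr.symm ▸ hx) ?_
    rw [map_sub, hrκ, hxr]
    convert J.mul_mem_left (c ^ (k + M)) hrt using 1
    ring
  have claim3 : ∀ j, CoveredMod (inrRange B K : Set (Dorroh B K))
      ((Ideal.span {c ^ j} * inrRange B K : Ideal (Dorroh B K)).toAddSubgroup :
        Set (Dorroh B K)) := by
    intro j
    induction j with
    | zero => exact ⟨{0}, Set.finite_singleton 0, by simp, fun x hx => ⟨0, rfl, by simpa using hx⟩⟩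
    | succ j ih =>
      refine ih.trans ?_
      refine ⟨(fun t => c ^ j * t) '' T, hT.image _, ?_, fun x hx => ?_⟩
      · rintro _ ⟨t, ht, rfl⟩
        exact Ideal.mem_span_singleton_mul.2 ⟨t, hTκ ht, rfl⟩
      · obtain ⟨y, hy, rfl⟩ := Ideal.mem_span_singleton_mul.1 hx
        obtain ⟨t, ht, hyt⟩ := hcov y hy
        obtain ⟨z, hz, he⟩ := Ideal.mem_span_singleton_mul.1 hyt
        refine ⟨_, ⟨t, ht, rfl⟩, Ideal.mem_span_singleton_mul.2 ⟨z, hz, ?_⟩⟩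
        rw [pow_succ, mul_assoc, he, mul_sub]
  intro u hu
  obtain ⟨i, j, hij, hm⟩ := (claim3 k).exists_sub_mem (fun n => u ^ (n + 1))
    (fun n => Ideal.pow_mem_of_mem _ hu _ n.succ_pos)
  obtain ⟨z, hz, he⟩ := Ideal.mem_span_singleton_mul.1 hm
  refine isIntegral_of_pow_sub_pow (Nat.succ_lt_succ hij) ?_
  exact he ▸ claim2 z hz

theorem exists_pow_mul_isIntegral {S U : Type*} [CommRing S] [CommRing U] [Algebra S U] (c : S)
    {C : Type*} [CommRing C] [Algebra C U] (hC : ∀ x : C, IsIntegral S (algebraMap C U x))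
    {s : Set U} (hs : Algebra.adjoin C s = ⊤)
    (h : ∀ x ∈ s, ∃ N, IsIntegral S (algebraMap S U c ^ N * x)) (u : U) :
    ∃ N, IsIntegral S (algebraMap S U c ^ N * u) := by
  have hcint : ∀ n, IsIntegral S (algebraMap S U c ^ n) := fun n => by
    rw [← map_pow]; exact isIntegral_algebraMap
  have hu : u ∈ Algebra.adjoin C s := hs ▸ Algebra.mem_top
  induction hu using Algebra.adjoin_induction with
  | mem x hx => exact h x hx
  | algebraMap r => exact ⟨0, by simpa using hC r⟩
  | add x y _ _ hx hy =>
    obtain ⟨M, hM⟩ := hx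
    obtain ⟨N, hN⟩ := hy
    refine ⟨M + N, ?_⟩
    have := ((hcint N).mul hM).add ((hcint M).mul hN)
    convert this using 1
    ring
  | mul x y _ _ hx hy =>
    obtain ⟨M, hM⟩ := hx
    obtain ⟨N, hN⟩ := hy
    refine ⟨M + N, ?_⟩
    convert hM.mul hN using 1
    ring

end Integrality

section Transfer

theorem FinitelySeparable.of_injective {K L : Type*} [NonUnitalRing K] [NonUnitalRing L]
    (hL : FinitelySeparable L) (f : K →ₙ+* L) (hf : Function.Injective f) :
    FinitelySeparable K := by
  intro a A ha
  have ha' : f a ∉ A.map f := by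
    rintro ⟨x, hx, he⟩
    exact ha (hf he ▸ hx)
  obtain ⟨F, i, i', φ, h⟩ := hL (f a) (A.map f) ha'
  refine ⟨F, i, i', φ.comp f, ?_⟩
  rintro ⟨x, hx, he⟩
  exact h ⟨f x, ⟨x, hx, rfl⟩, he⟩

section

variable {B K : Type*} [CommRing B] [NonUnitalCommRing K] [Module B K] [IsScalarTower B K K]
  [SMulCommClass B K K]

variable (B) in
theorem finitelySeparable_of_ideal
    (h : ∀ (A : NonUnitalSubring K) (a : K), a ∉ A → ∃ J : Ideal (Dorroh B K),
      Finite (Dorroh B K ⧸ J) ∧ ∀ x ∈ A, (Dorroh.inr (a - x) : Dorroh B K) ∉ J) :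
    FinitelySeparable K := by
  intro a A ha
  obtain ⟨J, hJ, hJA⟩ := h A a ha
  let e := (Shrink.ringEquiv.{0} (Dorroh B K ⧸ J)).symm
  let φ : K →ₙ+* Shrink.{0} (Dorroh B K ⧸ J) :=
    ((e : (Dorroh B K ⧸ J) →+* _).comp (Ideal.Quotient.mk J)).toNonUnitalRingHom.comp
      Dorroh.inr
  have hφ : ∀ x y, φ x = φ y ↔ (Dorroh.inr (x - y) : Dorroh B K) ∈ J := fun x y => by
    rw [map_sub, ← Ideal.Quotient.eq]
    exact e.injective.eq_iff
  refine ⟨_, inferInstance, Finite.of_equiv _ e.toEquiv, φ, ?_⟩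
  rintro ⟨x, hx, he⟩
  exact hJA x hx ((hφ a x).1 he.symm)

theorem finite_quotient_map_of_surjective {U V : Type*} [CommRing U] [CommRing V] {g : U →+* V}
    (hg : Function.Surjective g) (J : Ideal U) [Finite (U ⧸ J)] : Finite (V ⧸ J.map g) :=
  Finite.of_surjective (Ideal.quotientMap (J.map g) g Ideal.le_comap_map)
    (Ideal.quotientMap_surjective hg)

theorem FinitelySeparable.of_surjective_aux {L : Type*} [NonUnitalCommRing L] [Module B L]
    [IsScalarTower B L L] [SMulCommClass B L L] (hB : Function.Surjective (Int.cast : ℤ → B))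
    (hK : FinitelySeparable K) (f : K →ₙ+* L) (hf : Function.Surjective f) :
    FinitelySeparable L := by
  refine finitelySeparable_of_ideal B fun A a ha => ?_
  obtain ⟨b, rfl⟩ := hf a
  obtain ⟨J, hJ, hJA⟩ := exists_ideal_of_finitelySeparable hB hK (A := A.comap f) ha
  obtain ⟨g, hg0⟩ : ∃ g : Dorroh B K →+* Dorroh B L, g = Dorroh.lift hB ((Dorroh.inr : L →ₙ+* Dorroh B L).comp f) := ⟨_, rfl⟩
  have hgi : ∀ x : K, g (Dorroh.inr x) = Dorroh.inr (f x) := fun x => by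
    rw [hg0]
    exact Dorroh.lift_inr hB _ x
  have hga : ∀ b, g (algebraMap B _ b) = algebraMap B _ b := fun b => by
    rw [hg0]
    exact AlgHom.commutes (Dorroh.lift hB ((Dorroh.inr : L →ₙ+* Dorroh B L).comp f)) b
  have hg : ∀ u, g u = algebraMap B _ (Dorroh.fst u) + Dorroh.inr (f (Dorroh.snd u)) := by
    intro u
    conv_lhs => rw [← Dorroh.algebraMap_fst_add_inr_snd u]
    rw [map_add, hgi, hga]
  have hgs : Function.Surjective g := fun v => by
    obtain ⟨y, hy⟩ := hf (Dorroh.snd v)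
    refine ⟨algebraMap B _ (Dorroh.fst v) + Dorroh.inr y, ?_⟩
    rw [map_add, hgi, hga, hy, Dorroh.algebraMap_fst_add_inr_snd]
  refine ⟨J.map g, ?_, fun x hx h => ?_⟩
  · exact finite_quotient_map_of_surjective hgs J
  · obtain ⟨y, rfl⟩ := hf x
    obtain ⟨u, hu, he⟩ := (Ideal.mem_map_iff_of_surjective g hgs).1 h
    rw [hg, ← map_sub] at he
    have h1 : Dorroh.fst u = 0 := by simpa using congrArg Dorroh.fst he
    have h2 : f (Dorroh.snd u) = f (b - y) := by simpa using congrArg Dorroh.snd he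
    refine hJA (b - Dorroh.snd u) ?_ ?_
    · change f (b - Dorroh.snd u) ∈ A
      rw [map_sub, h2, map_sub, sub_sub_cancel]
      exact hx
    · rw [sub_sub_cancel, exists_inr_of_mem (mem_inrRange.2 h1)]
      exact hu

end

theorem FinitelySeparable.of_surjective {K L : Type*} [NonUnitalCommRing K] [NonUnitalCommRing L]
    (hK : FinitelySeparable K) (f : K →ₙ+* L) (hf : Function.Surjective f) :
    FinitelySeparable L :=
  FinitelySeparable.of_surjective_aux (B := ℤ) (fun n => ⟨n, rfl⟩) hK f hf

end Transfer

section PolynomialEvaluation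

variable {p : ℕ} {K U : Type*} [NonUnitalRing K]

theorem map_nupow {L : Type*} [NonUnitalRing L] (g : K →ₙ+* L) (a : K) (n : ℕ) :
    g (nupow a n) = nupow (g a) n := by
  induction n with
  | zero => rfl
  | succ n ih => simp [nupow, ih]

theorem map_pEval_eq {L : Type*} [NonUnitalRing L] (g : K →ₙ+* L) (f : Polynomial (ZMod p)) (a : K) :
    g (pEval f a) = pEval f (g a) := by
  simp only [pEval, map_sum, map_nsmul]
  refine Finset.sum_congr rfl fun i _ => ?_
  split_ifs <;> simp [map_nupow]

theorem map_monEval_eq {L : Type*} [NonUnitalRing L] (g : K →ₙ+* L) (m : Fin 2 →₀ ℕ) (a b : K) :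
    g (monEval a b m) = monEval (g a) (g b) m := by
  unfold monEval
  split_ifs <;> simp [map_nupow]

theorem map_mvEval_eq {L : Type*} [NonUnitalRing L] (g : K →ₙ+* L)
    (f : MvPolynomial (Fin 2) (ZMod p)) (a b : K) :
    g (mvEval a b f) = mvEval (g a) (g b) f := by
  simp only [mvEval, map_sum, map_nsmul, map_monEval_eq]

variable [CommRing U]

theorem nupow_eq_pow (u : U) (n : ℕ) : nupow u n = u ^ (n + 1) := by
  induction n with
  | zero => simp [nupow]
  | succ n ih => rw [nupow, ih, ← pow_succ]

variable [NeZero p] [Algebra (ZMod p) U]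

theorem val_nsmul (c : ZMod p) (u : U) : c.val • u = c • u := by
  rw [← Nat.cast_smul_eq_nsmul (ZMod p), ZMod.natCast_zmod_val]

theorem map_pEval (g : K →ₙ+* U) (a : K) {f : Polynomial (ZMod p)} (hf : f.coeff 0 = 0) :
    g (pEval f a) = Polynomial.aeval (g a) f := by
  rw [pEval, map_sum, Polynomial.aeval_eq_sum_range, Finset.sum_subset (s₂ := Finset.range (f.natDegree + 1))]
  · refine Finset.sum_congr rfl fun i _ => ?_
    rw [map_nsmul, val_nsmul]
    split_ifs with h
    · simp [h, hf]
    · rw [map_nupow, nupow_eq_pow, Nat.sub_add_cancel (Nat.pos_of_ne_zero h)]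
  · exact fun i hi => Finset.mem_range_succ_iff.2 (Polynomial.le_natDegree_of_mem_supp i hi)
  · intro i _ hi
    simp [Polynomial.notMem_support_iff.1 hi]

theorem map_monEval (g : K →ₙ+* U) (a b : K) {m : Fin 2 →₀ ℕ} (hm : m ≠ 0) :
    g (monEval a b m) = g a ^ m 0 * g b ^ m 1 := by
  unfold monEval
  split_ifs with h0 h1 h1
  · exact (hm (by ext i; fin_cases i <;> simp [h0, h1])).elim
  · rw [map_nupow, nupow_eq_pow, Nat.sub_add_cancel (Nat.pos_of_ne_zero h1), h0]; simp
  · rw [map_nupow, nupow_eq_pow, Nat.sub_add_cancel (Nat.pos_of_ne_zero h0), h1]; simp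
  · rw [map_mul, map_nupow, nupow_eq_pow, Nat.sub_add_cancel (Nat.pos_of_ne_zero h0), map_nupow,
      nupow_eq_pow, Nat.sub_add_cancel (Nat.pos_of_ne_zero h1)]

theorem map_mvEval (g : K →ₙ+* U) (a b : K) {f : MvPolynomial (Fin 2) (ZMod p)}
    (hf : MvPolynomial.constantCoeff f = 0) :
    g (mvEval a b f) = MvPolynomial.aeval ![g a, g b] f := by
  rw [mvEval, map_sum, MvPolynomial.aeval_def, MvPolynomial.eval₂_eq']
  refine Finset.sum_congr rfl fun m hm => ?_
  have hm0 : m ≠ 0 := by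
    rintro rfl
    exact MvPolynomial.mem_support_iff.1 hm hf
  rw [map_nsmul, val_nsmul, map_monEval g a b hm0, Algebra.smul_def]
  simp [Fin.prod_univ_two]

end PolynomialEvaluation

section IntegralDependence

variable {B K : Type*} [Field B] [NonUnitalCommRing K] [Module B K] [IsScalarTower B K K]
  [SMulCommClass B K K]

open Polynomial in
theorem isIntegralElem_of_closure_pair_eq_top {p : ℕ} (hp : p.Prime) [CharP B p]
    (hB : Function.Surjective (Int.cast : ℤ → B))
    (hdom : ∀ x y : K, x ≠ 0 → y ≠ 0 → x * y ≠ 0) (hK : FinitelySeparable K) {a b : K}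
    (hab : NonUnitalSubring.closure {a, b} = ⊤)
    (ha : ∀ f : B[X], f ≠ 0 → f.coeff 0 = 0 → aeval (Dorroh.inr a : Dorroh B K) f ≠ 0) :
    (aeval (R := B) (Dorroh.inr a : Dorroh B K)).toRingHom.IsIntegralElem (Dorroh.inr b) := by
  classical
  have hft : Algebra.FiniteType B (Dorroh B K) := finiteType_dorroh ⟨{a, b}, by simpa using hab⟩
  have hN : IsNoetherianRing (Dorroh B K) := Algebra.FiniteType.isNoetherianRing B _
  have hBc : Countable B := hB.countable
  have hUc : Countable (Dorroh B K) := countable_of_finiteType B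
  have hIc : Countable (Ideal (Dorroh B K)) := countable_ideal
  set α : Dorroh B K := Dorroh.inr a with hα
  set β : Dorroh B K := Dorroh.inr b with hβ
  let _ : Algebra B[X] (Dorroh B K) := (aeval (R := B) α).toRingHom.toAlgebra
  have halg : ∀ f : B[X], algebraMap B[X] (Dorroh B K) f = aeval α f := fun _ => rfl
  have htower : IsScalarTower B B[X] (Dorroh B K) := IsScalarTower.of_algebraMap_eq fun x => by
    rw [halg, algebraMap_eq, aeval_C]
  have ha0 : a ≠ 0 := by
    rintro rfl
    exact ha X X_ne_zero (by simp) (by simp [hα])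
  have hreg_inr : ∀ x : K, x ≠ 0 → ∀ u ∈ inrRange B K, (Dorroh.inr x : Dorroh B K) * u = 0 →
      u = 0 := by
    intro x hx u hu h
    rw [← exists_inr_of_mem hu] at h ⊢
    rw [← map_mul, ← map_zero Dorroh.inr] at h
    have := Dorroh.inr_injective h
    by_contra hne
    exact hdom x _ hx (fun h0 => hne (by rw [h0, map_zero])) this
  have hp0 : (p : Dorroh B K) = 0 := by
    rw [← map_natCast (algebraMap B (Dorroh B K)), CharP.cast_eq_zero, map_zero]
  have hcov : ∀ c : Dorroh B K, (∀ u ∈ inrRange B K, c * u = 0 → u = 0) →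
      CoveredMod (inrRange B K : Set (Dorroh B K))
        ((Ideal.span {c} * inrRange B K : Ideal (Dorroh B K)) : Set (Dorroh B K)) := fun c hc =>
    coveredMod_mul_of_finitelySeparable hB hK hp c hc fun u _ =>
      ⟨0, Ideal.zero_mem _, by rw [hp0, zero_mul, mul_zero, mul_zero]⟩
  have hadj : Algebra.adjoin B[X] {β} = ⊤ := by
    have h1 := adjoin_inr_eq_top (B := B) hab
    rw [eq_top_iff]
    rintro u -
    have hu : u ∈ Algebra.adjoin B ((Dorroh.inr : K → Dorroh B K) '' {a, b}) :=
      h1 ▸ Algebra.mem_top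
    induction hu using Algebra.adjoin_induction with
    | mem x hx =>
      obtain ⟨y, rfl | rfl, rfl⟩ := hx
      · have : algebraMap B[X] (Dorroh B K) X = α := by rw [halg, aeval_X]
        rw [← hα, ← this]
        exact Subalgebra.algebraMap_mem _ _
      · exact Algebra.subset_adjoin rfl
    | algebraMap r =>
      rw [IsScalarTower.algebraMap_apply B B[X]]
      exact Subalgebra.algebraMap_mem _ _
    | add x y _ _ hx hy => exact Subalgebra.add_mem _ hx hy
    | mul x y _ _ hx hy => exact Subalgebra.mul_mem _ hx hy
  obtain ⟨i, j, hij, hmem⟩ := (CoveredMod.exists_sub_mem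
    (Y := (Ideal.span {α} * inrRange B K : Ideal (Dorroh B K)).toAddSubgroup)
    (hcov α (hreg_inr a ha0)) (fun n => β ^ (n + 1))
    (fun n => Ideal.pow_mem_of_mem _ (inr_mem_inrRange b) _ n.succ_pos))
  obtain ⟨h, -, hh⟩ := Ideal.mem_span_singleton_mul.1 hmem
  obtain ⟨H, hH⟩ : ∃ H : B[X][X], aeval β H = h := by
    have : h ∈ Algebra.adjoin B[X] {β} := hadj ▸ Algebra.mem_top
    rw [Algebra.adjoin_singleton_eq_range_aeval] at this
    exact this
  set f : B[X][X] := X ^ (i + 1) - X ^ (j + 1) - C X * H with hf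
  have hf0 : f ≠ 0 := by
    intro h0
    have := congrArg (fun g => (g.map (evalRingHom (0 : B))).coeff (i + 1)) h0
    simp [hf, coeff_X_pow, hij.ne] at this
  have hfβ : aeval β f = 0 := by
    have hX : algebraMap B[X] (Dorroh B K) X = α := by rw [halg, aeval_X]
    simp only [hf, map_sub, map_mul, map_pow, aeval_X, aeval_C, hX, hH, hh, sub_self]
  have hc0 : f.leadingCoeff ≠ 0 := leadingCoeff_ne_zero.2 hf0
  have hregc : ∀ u ∈ inrRange B K, algebraMap B[X] (Dorroh B K) f.leadingCoeff * u = 0 →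
      u = 0 := by
    intro u hu h0
    have hXc : (aeval α (X * f.leadingCoeff)) ∈ inrRange B K := by
      rw [map_mul, aeval_X]
      exact Ideal.mul_mem_right _ _ (inr_mem_inrRange a)
    have hne : aeval α (X * f.leadingCoeff) ≠ 0 :=
      ha _ (mul_ne_zero X_ne_zero hc0) (by simp)
    rw [← exists_inr_of_mem hXc] at hne
    refine hreg_inr (Dorroh.snd (aeval α (X * f.leadingCoeff)))
      (fun h1 => hne (by rw [h1, map_zero])) u hu ?_
    rw [exists_inr_of_mem hXc, map_mul, mul_assoc, ← halg f.leadingCoeff, h0,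
      mul_zero]
  have h_int := isIntegral_of_finitelySeparable hB hK f.leadingCoeff (hcov _ hregc) (fun u _ =>
    exists_pow_mul_isIntegral f.leadingCoeff (C := B[X]) (fun x => isIntegral_algebraMap) hadj
      (by
        rintro x rfl
        refine ⟨1, ?_⟩
        rw [pow_one, ← Algebra.smul_def]
        exact isIntegral_leadingCoeff_smul f β hfβ) u)
  exact h_int β (inr_mem_inrRange b)

end IntegralDependence

section MonicInTwoVariables

open MvPolynomial

theorem degreeOf_aeval_X {σ R : Type*} [CommRing R] [Nontrivial R] {i j : σ} (hij : i ≠ j) (g : Polynomial R) :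
    degreeOf j (Polynomial.aeval (X i : MvPolynomial σ R) g) = 0 := by
  induction g using Polynomial.induction_on' with
  | add f g hf hg =>
    have := degreeOf_add_le j (Polynomial.aeval (X i : MvPolynomial σ R) f)
      (Polynomial.aeval (X i : MvPolynomial σ R) g)
    rw [map_add]
    omega
  | monomial n a =>
    rw [Polynomial.aeval_monomial, algebraMap_eq]
    have := degreeOf_C_mul_le (X i ^ n : MvPolynomial σ R) j a
    rw [degreeOf_X_pow_of_ne _ hij.symm] at this
    omega

theorem exists_monic_of_isIntegralElem {σ R U : Type*} [CommRing R] [Nontrivial R] [CommRing U]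
    [Algebra R U]
    {v : σ → U} {i j : σ} (hij : i ≠ j)
    (h : (Polynomial.aeval (R := R) (v i)).toRingHom.IsIntegralElem (v j)) :
    ∃ d, 0 < d ∧ ∃ E : MvPolynomial σ R, degreeOf j E < d ∧ aeval v (X j ^ d + E) = 0 := by
  obtain ⟨G, hG, hG0⟩ := h
  refine ⟨G.natDegree + 1, Nat.succ_pos _,
    ∑ k ∈ Finset.range G.natDegree, Polynomial.aeval (X i) (G.coeff k) * X j ^ (k + 1), ?_, ?_⟩
  · refine (degreeOf_sum_le _ _ _).trans_lt ((Finset.sup_lt_iff (Nat.succ_pos _)).2 fun k hk => ?_)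
    have h1 := degreeOf_mul_le j (Polynomial.aeval (X i : MvPolynomial σ R) (G.coeff k))
      (X j ^ (k + 1))
    rw [degreeOf_aeval_X hij, degreeOf_X_self_pow] at h1
    have := Finset.mem_range.1 hk
    omega
  · have h2 : ∀ g : Polynomial R, aeval v (Polynomial.aeval (X i : MvPolynomial σ R) g) =
        Polynomial.aeval (v i) g := fun g => by
      rw [← Polynomial.aeval_algHom_apply, aeval_X]
    rw [hG.as_sum] at hG0
    simp only [Polynomial.eval₂_add, Polynomial.eval₂_pow, Polynomial.eval₂_X,
      Polynomial.eval₂_finsetSum, Polynomial.eval₂_mul, Polynomial.eval₂_C] at hG0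
    have h3 := congrArg (· * v j) hG0
    simp only [add_mul, zero_mul, Finset.sum_mul] at h3
    simp only [map_add, map_sum, map_mul, map_pow, aeval_X, h2]
    rw [← h3, pow_succ]
    congr 1
    exact Finset.sum_congr rfl fun k _ => by rw [pow_succ, mul_assoc]; rfl

theorem monicInVar_of_degreeOf_lt {p : ℕ} [Fact p.Prime] {g : MvPolynomial (Fin 2) (ZMod p)}
    {j : Fin 2} {N : ℕ} (hg : degreeOf j g < N) : MonicInVar (X j ^ N + g) j := by
  have hg0 : ∀ m, coeff m g ≠ 0 → m j < N := fun m hm =>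
    (monomial_le_degreeOf j (mem_support_iff.2 hm)).trans_lt hg
  have hc : coeff (Finsupp.single j N) (X j ^ N + g) = 1 := by
    rw [coeff_add, coeff_X_pow, if_pos rfl]
    have : coeff (Finsupp.single j N) g = 0 := by
      by_contra h
      have := hg0 _ h
      simp at this
    rw [this, add_zero]
  have hd : degreeOf j (X j ^ N + g) = N := by
    refine le_antisymm ?_ ?_
    · have := degreeOf_add_le j (X j ^ N) g
      rw [degreeOf_X_self_pow] at this
      omega
    · have := monomial_le_degreeOf j (mem_support_iff.2 (hc.trans_ne one_ne_zero))
      simpa using this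
  refine ⟨by rw [hd, hc], fun m hm hmj => ?_⟩
  rw [hd] at hmj ⊢
  by_contra hne
  rw [mem_support_iff, coeff_add, coeff_X_pow, if_neg (Ne.symm hne), zero_add] at hm
  exact (hg0 m hm).ne hmj

theorem exists_monicInVar {p : ℕ} [Fact p.Prime] {U : Type*} [CommRing U] [Algebra (ZMod p) U]
    {α β : U} (h1 : (Polynomial.aeval (R := ZMod p) α).toRingHom.IsIntegralElem β)
    (h2 : (Polynomial.aeval (R := ZMod p) β).toRingHom.IsIntegralElem α) :
    ∃ f : MvPolynomial (Fin 2) (ZMod p), constantCoeff f = 0 ∧ MonicInVar f 0 ∧ MonicInVar f 1 ∧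
      aeval ![α, β] f = 0 := by
  obtain ⟨d1, hd1, E1, hE1, h1⟩ :=
    exists_monic_of_isIntegralElem (v := ![α, β]) (i := 0) (j := 1) (by decide) h1
  obtain ⟨d2, hd2, E2, hE2, h2⟩ :=
    exists_monic_of_isIntegralElem (v := ![α, β]) (i := 1) (j := 0) (by decide) h2
  set F1 := X 1 ^ d1 + E1 with hF1
  set F2 := X 0 ^ d2 + E2 with hF2
  set s := degreeOf 1 F2 + 1 with hs
  set r := degreeOf 0 F1 + 1 with hr
  have b1 := degreeOf_mul_le 1 E1 (X 1 ^ s)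
  have b2 := degreeOf_mul_le 1 F2 (X 0 ^ r)
  have b3 := degreeOf_mul_le 0 E2 (X 0 ^ r)
  have b4 := degreeOf_mul_le 0 F1 (X 1 ^ s)
  rw [degreeOf_X_self_pow] at b1 b3
  rw [degreeOf_X_pow_of_ne _ (by decide)] at b2 b4
  refine ⟨F1 * X 1 ^ s + F2 * X 0 ^ r, ?_, ?_, ?_, ?_⟩
  · simp [hs, hr]
  · have : F1 * X 1 ^ s + F2 * X 0 ^ r = X 0 ^ (d2 + r) + (E2 * X 0 ^ r + F1 * X 1 ^ s) := by
      rw [hF2, pow_add]; ring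
    rw [this]
    refine monicInVar_of_degreeOf_lt ?_
    have := degreeOf_add_le 0 (E2 * X 0 ^ r) (F1 * X 1 ^ s)
    omega
  · have : F1 * X 1 ^ s + F2 * X 0 ^ r = X 1 ^ (d1 + s) + (E1 * X 1 ^ s + F2 * X 0 ^ r) := by
      rw [hF1, pow_add]; ring
    rw [this]
    refine monicInVar_of_degreeOf_lt ?_
    have := degreeOf_add_le 1 (E1 * X 1 ^ s) (F2 * X 0 ^ r)
    omega
  · rw [map_add, map_mul, map_mul, h1, h2, zero_mul, zero_mul, add_zero]

end MonicInTwoVariables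

section

theorem closure_preimage_closure_eq_top {K : Type*} [NonUnitalRing K] (s : Set K) :
    NonUnitalSubring.closure ((↑) ⁻¹' s : Set (NonUnitalSubring.closure s)) = ⊤ := by
  rw [eq_top_iff]
  rintro ⟨x, hx⟩ -
  induction hx using NonUnitalSubring.closure_induction with
  | mem x hx => exact NonUnitalSubring.subset_closure hx
  | zero => exact NonUnitalSubring.zero_mem _
  | add x y _ _ hx hy => exact NonUnitalSubring.add_mem _ hx hy
  | neg x _ hx => exact NonUnitalSubring.neg_mem _ hx
  | mul x y _ _ hx hy => exact NonUnitalSubring.mul_mem _ hx hy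

theorem integrallyDependent_of_closure_pair {K : Type*} [NonUnitalCommRing K] {p : ℕ}
    [Fact p.Prime] (hp : ∀ c : K, p • c = 0)
    (hdom : ∀ x y : K, x ≠ 0 → y ≠ 0 → x * y ≠ 0) (hK : FinitelySeparable K) {a b : K}
    (hab : NonUnitalSubring.closure {a, b} = ⊤)
    (ha : IsTranscendentalElt p a) (hb : IsTranscendentalElt p b) :
    IntegrallyDependent p a b := by
  let _ : Module (ZMod p) K := AddCommGroup.zmodModule hp
  have hB : Function.Surjective (Int.cast : ℤ → ZMod p) := ZMod.intCast_surjective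
  have _ : IsScalarTower (ZMod p) K K := ⟨fun r x y => by
    obtain ⟨n, rfl⟩ := hB r
    simp only [smul_eq_mul, Int.cast_smul_eq_zsmul, smul_mul_assoc]⟩
  have _ : SMulCommClass (ZMod p) K K := ⟨fun r x y => by
    obtain ⟨n, rfl⟩ := hB r
    simp only [smul_eq_mul, Int.cast_smul_eq_zsmul, mul_smul_comm]⟩
  have htr : ∀ x : K, IsTranscendentalElt p x → ∀ f : Polynomial (ZMod p), f ≠ 0 →
      f.coeff 0 = 0 → Polynomial.aeval (Dorroh.inr x : Dorroh (ZMod p) K) f ≠ 0 := by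
    intro x hx f hf hf0 h
    rw [← map_pEval Dorroh.inr x hf0, ← map_zero Dorroh.inr] at h
    exact hx f hf hf0 (Dorroh.inr_injective h)
  have hP : p.Prime := Fact.out
  obtain ⟨f, hf0, hfm0, hfm1, hf⟩ := exists_monicInVar
    (isIntegralElem_of_closure_pair_eq_top hP hB hdom hK hab (htr a ha))
    (isIntegralElem_of_closure_pair_eq_top hP hB hdom hK (by rwa [Set.pair_comm]) (htr b hb))
  refine ⟨f, hf0, hfm0, hfm1, Dorroh.inr_injective (B := ZMod p) ?_⟩
  rw [map_mvEval _ _ _ hf0, hf, map_zero]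

theorem integrallyDependent_of_finitelySeparable {K : Type*} [NonUnitalCommRing K] {p : ℕ}
    (hP : p.Prime) (hp : ∀ c : K, p • c = 0)
    (hdom : ∀ x y : K, x ≠ 0 → y ≠ 0 → x * y ≠ 0) (hK : FinitelySeparable K) {a b : K}
    (ha : IsTranscendentalElt p a) (hb : IsTranscendentalElt p b) :
    IntegrallyDependent p a b := by
  have _ : Fact p.Prime := ⟨hP⟩
  let L := NonUnitalSubring.closure {a, b}
  let g : L →ₙ+* K := NonUnitalSubringClass.subtype L
  have hg : Function.Injective g := Subtype.val_injective
  let a' : L := ⟨a, NonUnitalSubring.subset_closure (by simp)⟩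
  let b' : L := ⟨b, NonUnitalSubring.subset_closure (by simp)⟩
  have htr : ∀ x : L, IsTranscendentalElt p (g x) → IsTranscendentalElt p x :=
    fun x hx f hf hf0 h => hx f hf hf0 (by rw [← map_pEval_eq, h, map_zero])
  have hab : NonUnitalSubring.closure {a', b'} = ⊤ := by
    rw [← closure_preimage_closure_eq_top {a, b}]
    congr 1
    ext ⟨x, hx⟩
    simp [a', b']
  obtain ⟨f, h0, h1, h2, h3⟩ := integrallyDependent_of_closure_pair (a := a') (b := b')
    (fun c => hg (by rw [map_nsmul, hp, map_zero]))
    (fun x y hx hy h => hdom (g x) (g y) (fun h' => hx (hg (by rw [h', map_zero])))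
      (fun h' => hy (hg (by rw [h', map_zero]))) (by rw [← map_mul, h, map_zero]))
    (FinitelySeparable.of_injective hK g hg) hab (htr _ ha) (htr _ hb)
  exact ⟨f, h0, h1, h2, by have := congrArg g h3; rwa [map_mvEval_eq, map_zero] at this⟩

end

section Torsion

theorem exists_torsion_bound (U : Type*) [CommRing U] [IsNoetherianRing U] :
    ∃ m : ℕ, 0 < m ∧ ∀ (u : U) (n : ℕ), 0 < n → (n : U) * u = 0 → (m : U) * u = 0 := by
  let f : ℕ →o Ideal U :=
    { toFun := fun n => LinearMap.ker (LinearMap.lsmul U U (n.factorial : U))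
      monotone' := fun n m h u hu => by
        rw [LinearMap.mem_ker, LinearMap.lsmul_apply, smul_eq_mul] at hu ⊢
        obtain ⟨c, hc⟩ := Nat.factorial_dvd_factorial h
        rw [hc, Nat.cast_mul, mul_right_comm, hu, zero_mul] }
  have hmem : ∀ n u, u ∈ f n ↔ (n.factorial : U) * u = 0 := fun n u => Iff.rfl
  obtain ⟨N, hN⟩ := monotone_stabilizes_iff_noetherian.2 ‹_› f
  refine ⟨N.factorial, N.factorial_pos, fun u n hn h => ?_⟩
  rw [← hmem, hN _ (le_max_left N n), hmem]
  obtain ⟨c, hc⟩ := Nat.dvd_factorial hn (le_max_right N n)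
  rw [hc, Nat.cast_mul, mul_right_comm, h, zero_mul]

theorem coveredMod_natCast_mul {U : Type*} [CommRing U] {L M : Ideal U}
    (h : ∀ p : ℕ, p.Prime → CoveredMod (L : Set U) ((M ⊔ Ideal.span {(p : U)} * L : Ideal U) : Set U))
    (n : ℕ) (hn : n ≠ 0) :
    CoveredMod (L : Set U) ((M ⊔ Ideal.span {(n : U)} * L : Ideal U) : Set U) := by
  induction n using induction_on_primes with
  | zero => exact (hn rfl).elim
  | one =>
    refine ⟨{0}, Set.finite_singleton 0, by simp, fun x hx => ⟨0, rfl, ?_⟩⟩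
    simpa using Ideal.mem_sup_right hx
  | prime_mul p a hp ih =>
    have ha := ih (right_ne_zero_of_mul hn)
    refine CoveredMod.trans (Z := (M ⊔ Ideal.span {((p * a : ℕ) : U)} * L : Ideal U).toAddSubgroup)
      (h p hp) ?_
    obtain ⟨T, hT, hTL, hc⟩ := ha
    refine ⟨(fun t => (p : U) * t) '' T, hT.image _, ?_, fun x hx => ?_⟩
    · rintro _ ⟨t, ht, rfl⟩
      exact Ideal.mem_sup_right (Ideal.mem_span_singleton_mul.2 ⟨t, hTL ht, rfl⟩)
    · obtain ⟨y, hy, z, hz, rfl⟩ := Submodule.mem_sup.1 hx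
      obtain ⟨l, hl, rfl⟩ := Ideal.mem_span_singleton_mul.1 hz
      obtain ⟨t, ht, hlt⟩ := hc l hl
      refine ⟨_, ⟨t, ht, rfl⟩, ?_⟩
      obtain ⟨y', hy', z', hz', he⟩ := Submodule.mem_sup.1 hlt
      obtain ⟨l', hl', rfl⟩ := Ideal.mem_span_singleton_mul.1 hz'
      refine Submodule.mem_sup.2 ⟨y + p * y', Ideal.add_mem _ hy (Ideal.mul_mem_left _ _ hy'), _,
        Ideal.mem_span_singleton_mul.2 ⟨l', hl', rfl⟩, ?_⟩
      rw [add_sub_assoc, ← mul_sub, ← he]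
      push_cast
      ring

end Torsion

section TorsionFree

variable {B K : Type*} [CommRing B] [NonUnitalCommRing K] [Module B K] [IsScalarTower B K K]
  [SMulCommClass B K K]

theorem noetherian_countable_dorroh [IsNoetherianRing B]
    (hB : Function.Surjective (Int.cast : ℤ → B))
    (hfg : ∃ S : Finset K, NonUnitalSubring.closure (S : Set K) = ⊤) :
    Algebra.FiniteType B (Dorroh B K) ∧ IsNoetherianRing (Dorroh B K) ∧
      Countable (Ideal (Dorroh B K)) := by
  have h1 : Algebra.FiniteType B (Dorroh B K) := finiteType_dorroh hfg
  have h2 : IsNoetherianRing (Dorroh B K) := Algebra.FiniteType.isNoetherianRing B _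
  have h3 : Countable B := hB.countable
  have h4 : Countable (Dorroh B K) := countable_of_finiteType B
  exact ⟨h1, h2, countable_ideal⟩

theorem natCast_mul_inr (n : ℕ) (x : K) :
    (n : Dorroh B K) * Dorroh.inr x = Dorroh.inr (n • x) := by
  rw [← nsmul_eq_mul, map_nsmul]

theorem coveredMod_of_torsionFree [Countable (Ideal (Dorroh B K))]
    (hB : Function.Surjective (Int.cast : ℤ → B)) (hK : FinitelySeparable K)
    (htf : ∀ (n : ℕ) (x : K), n ≠ 0 → n • x = 0 → x = 0) (n : ℕ) (hn : n ≠ 0) :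
    CoveredMod (inrRange B K : Set (Dorroh B K))
      ((Ideal.span {(n : Dorroh B K)} * inrRange B K : Ideal (Dorroh B K)) :
        Set (Dorroh B K)) := by
  rw [← bot_sup_eq (Ideal.span {(n : Dorroh B K)} * inrRange B K)]
  refine coveredMod_natCast_mul (fun p hp => ?_) n hn
  rw [bot_sup_eq]
  refine coveredMod_mul_of_finitelySeparable hB hK hp _ (fun u hu h => ?_)
    fun u hu => ⟨u, hu, rfl⟩
  rw [← exists_inr_of_mem hu] at h ⊢
  rw [natCast_mul_inr, ← map_zero Dorroh.inr] at h
  rw [htf p _ hp.ne_zero (Dorroh.inr_injective h), map_zero]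

open Polynomial in
theorem exists_nsmul_isIntegral_of_closure_singleton [IsNoetherianRing B]
    (hB : Function.Surjective (Int.cast : ℤ → B)) (h2 : ¬ IsUnit (2 : B))
    (hK : FinitelySeparable K)
    (htf : ∀ (n : ℕ) (x : K), n ≠ 0 → n • x = 0 → x = 0) {a : K}
    (ha : NonUnitalSubring.closure {a} = ⊤) :
    ∃ n : ℕ, n ≠ 0 ∧ IsIntegral B ((n : Dorroh B K) * Dorroh.inr a) := by
  obtain ⟨-, -, _⟩ := noetherian_countable_dorroh (B := B) (K := K) hB ⟨{a}, by simpa using ha⟩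
  set β : Dorroh B K := Dorroh.inr a with hβ
  have hadj := adjoin_inr_eq_top (B := B) ha
  rw [Set.image_singleton, ← hβ] at hadj
  obtain ⟨i, j, hij, hmem⟩ := (CoveredMod.exists_sub_mem
    (Y := (Ideal.span {((2 : ℕ) : Dorroh B K)} * inrRange B K : Ideal (Dorroh B K)).toAddSubgroup)
    (coveredMod_of_torsionFree hB hK htf 2 two_ne_zero) (fun n => β ^ (n + 1))
    (fun n => Ideal.pow_mem_of_mem _ (inr_mem_inrRange a) _ n.succ_pos))
  obtain ⟨h, -, hh⟩ := Ideal.mem_span_singleton_mul.1 hmem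
  obtain ⟨H, hH⟩ : ∃ H : B[X], aeval β H = h := by
    have : h ∈ Algebra.adjoin B {β} := hadj ▸ Algebra.mem_top
    rw [Algebra.adjoin_singleton_eq_range_aeval] at this
    exact this
  set f : B[X] := X ^ (i + 1) - X ^ (j + 1) - C 2 * H with hf
  have hf0 : f ≠ 0 := by
    intro h0
    have := congrArg (fun g => g.coeff (i + 1)) h0
    simp only [hf, coeff_sub, coeff_X_pow, coeff_C_mul, coeff_zero, if_true,
      if_neg (Nat.succ_injective.ne hij.ne), sub_zero] at this
    exact h2 (IsUnit.of_mul_eq_one _ (sub_eq_zero.1 this).symm)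
  have hfβ : aeval β f = 0 := by
    simp only [hf, map_sub, map_mul, map_pow, aeval_X, hH, ← hh, map_ofNat,
      Nat.cast_ofNat, sub_self]
  obtain ⟨c, hc⟩ := hB f.leadingCoeff
  have hi := isIntegral_leadingCoeff_smul f β hfβ
  rw [← hc, Int.cast_smul_eq_zsmul] at hi
  refine ⟨c.natAbs, ?_, ?_⟩
  · rw [Int.natAbs_ne_zero]
    rintro rfl
    exact hf0 (leadingCoeff_eq_zero.1 (by rw [← hc, Int.cast_zero]))
  · rw [← nsmul_eq_mul]
    rcases Int.natAbs_eq c with h | h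
    · rw [h, natCast_zsmul] at hi
      exact hi
    · rw [h, neg_smul, natCast_zsmul] at hi
      simpa using hi.neg

theorem finite_of_torsionFree [IsNoetherianRing B]
    (hB : Function.Surjective (Int.cast : ℤ → B)) (h2 : ¬ IsUnit (2 : B))
    (hfg : ∃ S : Finset K, NonUnitalSubring.closure (S : Set K) = ⊤)
    (hK : FinitelySeparable K)
    (htf : ∀ (n : ℕ) (x : K), n ≠ 0 → n • x = 0 → x = 0) : Module.Finite B K := by
  classical
  obtain ⟨hft, hN, _⟩ := noetherian_countable_dorroh (B := B) (K := K) hB hfg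
  obtain ⟨S, hS⟩ := hfg
  have hx : ∀ x : K, ∃ n : ℕ, n ≠ 0 ∧ IsIntegral B ((n : Dorroh B K) * Dorroh.inr x) := by
    intro x
    let L := NonUnitalSubring.closure {x}
    let g : L →ₙ+* K := NonUnitalSubringClass.subtype L
    have hg : Function.Injective g := Subtype.val_injective
    let a : L := ⟨x, NonUnitalSubring.subset_closure rfl⟩
    have ha : NonUnitalSubring.closure {a} = ⊤ := by
      rw [← closure_preimage_closure_eq_top {x}]
      congr 1
      ext ⟨y, hy⟩
      simp [a]
    let _ : Module B L := ({ L with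
      smul_mem' := fun b x hx => by
        obtain ⟨n, rfl⟩ := hB b
        rw [Int.cast_smul_eq_zsmul]
        exact zsmul_mem (show x ∈ L from hx) n } : Submodule B K).module
    have hsmul : ∀ (b : B) (x : L), g (b • x) = b • g x := fun _ _ => rfl
    have _ : IsScalarTower B L L := ⟨fun r x y => hg (by
      simp only [smul_eq_mul, map_mul, hsmul, smul_mul_assoc])⟩
    have _ : SMulCommClass B L L := ⟨fun r x y => hg (by
      simp only [smul_eq_mul, map_mul, hsmul, mul_smul_comm])⟩
    obtain ⟨n, hn, hi⟩ := exists_nsmul_isIntegral_of_closure_singleton hB h2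
      (FinitelySeparable.of_injective hK g hg)
      (fun n x hn h => hg (by rw [map_zero]; exact htf n _ hn (by rw [← map_nsmul, h, map_zero]))) ha
    refine ⟨n, hn, ?_⟩
    have := hi.map (Dorroh.lift hB ((Dorroh.inr : K →ₙ+* Dorroh B K).comp g))
    rw [map_mul, map_natCast, Dorroh.lift_inr] at this
    exact this
  choose c hc0 hc using hx
  have hsx : ∀ x ∈ S, ∃ N, IsIntegral B
      (algebraMap B (Dorroh B K) ((∏ x ∈ S, c x : ℕ) : B) ^ N * Dorroh.inr x) := by
    intro x hx
    refine ⟨1, ?_⟩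
    rw [pow_one, map_natCast, ← Finset.prod_erase_mul _ _ hx, Nat.cast_mul, mul_assoc]
    refine IsIntegral.mul ?_ (hc x)
    rw [← map_natCast (algebraMap B (Dorroh B K))]
    exact isIntegral_algebraMap
  have h_int := isIntegral_of_finitelySeparable hB hK ((∏ x ∈ S, c x : ℕ) : B)
    (by
      rw [map_natCast]
      exact coveredMod_of_torsionFree hB hK htf _ (Finset.prod_ne_zero_iff.2 fun x _ => hc0 x))
    (fun u _ => exists_pow_mul_isIntegral _ (C := B) (fun x => isIntegral_algebraMap)
      (adjoin_inr_eq_top hS) (by rintro _ ⟨x, hx, rfl⟩; exact hsx x hx) u)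
  have _ : Algebra.IsIntegral B (Dorroh B K) := ⟨fun u => by
    rw [← Dorroh.algebraMap_fst_add_inr_snd u]
    exact isIntegral_algebraMap.add (h_int _ (inr_mem_inrRange _))⟩
  have _ : Module.Finite B (Dorroh B K) := Algebra.IsIntegral.finite
  refine Module.Finite.of_surjective ({ Dorroh.snd with
    map_smul' := fun b u => ?_ } : Dorroh B K →ₗ[B] K) fun x => ⟨Dorroh.inr x, rfl⟩
  change Dorroh.snd (b • u) = b • Dorroh.snd u
  rw [Algebra.smul_def, Dorroh.snd_mul]
  simp

end TorsionFree

section TorsionQuotient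

theorem fg_quotient_torsion_iff {K : Type*} [NonUnitalCommRing K] (k : ℕ) :
    AddGroup.FG (K ⧸ torsionAddSubgroup K k) ↔ (nsmulAddMonoidHom (α := K) k).range.FG := by
  have h : torsionAddSubgroup K k = (nsmulAddMonoidHom (α := K) k).ker := rfl
  rw [← AddGroup.fg_iff_addSubgroup_fg, h]
  let e := QuotientAddGroup.quotientKerEquivRange (nsmulAddMonoidHom (α := K) k)
  exact ⟨fun _ => AddGroup.fg_of_surjective (f := e.toAddMonoidHom) e.surjective,
    fun _ => AddGroup.fg_of_surjective (f := e.symm.toAddMonoidHom) e.symm.surjective⟩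

variable {B K : Type*} [CommRing B] [NonUnitalCommRing K] [Module B K] [IsScalarTower B K K]
  [SMulCommClass B K K]

theorem finite_ideal_of_pow_eq_bot [Countable (Ideal (Dorroh B K))]
    (hB : Function.Surjective (Int.cast : ℤ → B)) (hK : FinitelySeparable K)
    {n : ℕ} (hn : n ≠ 0) (i : ℕ) {L : Ideal (Dorroh B K)} (hL : L ≤ inrRange B K)
    (hnL : Ideal.span {(n : Dorroh B K)} * L = ⊥) (hi : L ^ (2 ^ i) = ⊥) :
    (L : Set (Dorroh B K)).Finite := by
  induction i generalizing L with
  | zero =>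
    rw [pow_zero, pow_one] at hi
    rw [hi]
    exact Set.finite_singleton 0
  | succ i ih =>
    have h1 : ((L * L : Ideal _) : Set (Dorroh B K)).Finite := by
      refine ih (Ideal.mul_le_left.trans hL) ?_ ?_
      · rw [← mul_assoc, hnL, Ideal.bot_mul]
      · rw [← pow_two, ← pow_mul, ← pow_succ', hi]
    have h2 := coveredMod_natCast_mul (L := L) (M := L * L)
      (fun p hp => coveredMod_ideal_sq hB hK hL hp) n hn
    rw [hnL, sup_bot_eq] at h2
    refine CoveredMod.finite_of_bot (CoveredMod.trans (Z := ⊥) h2 ?_)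
    exact ⟨_, h1, subset_rfl, fun x hx => ⟨x, hx, by simp⟩⟩

theorem fg_range_of_torsion_bound
    (hfg : ∃ S : Finset K, NonUnitalSubring.closure (S : Set K) = ⊤) (hK : FinitelySeparable K)
    {m : ℕ} (hm : m ≠ 0) (htors : ∀ (x : K) (n : ℕ), n ≠ 0 → n • x = 0 → m • x = 0) :
    (nsmulAddMonoidHom (α := K) m).range.FG := by
  classical
  rw [← fg_quotient_torsion_iff]
  let U := Dorroh ℤ K
  let I : Ideal U := LinearMap.ker (LinearMap.lsmul U U (m : U))
  let f : K →ₙ+* U ⧸ I := (Ideal.Quotient.mk I).toNonUnitalRingHom.comp Dorroh.inr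
  have hf0 : ∀ x, f x = 0 ↔ m • x = 0 := by
    intro x
    have : f x = 0 ↔ (m : U) * Dorroh.inr x = 0 :=
      Ideal.Quotient.eq_zero_iff_mem (I := I) (a := Dorroh.inr x)
    rw [this, natCast_mul_inr]
    exact map_eq_zero_iff Dorroh.inr Dorroh.inr_injective
  let g : K →ₙ+* f.range := f.rangeRestrict
  have hg : Function.Surjective g := f.rangeRestrict_surjective
  have hg0 : ∀ x, g x = 0 ↔ m • x = 0 := fun x => by
    rw [← hf0]; exact Subtype.ext_iff
  have hfin : Module.Finite ℤ f.range := by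
    refine finite_of_torsionFree (B := ℤ) (fun n => ⟨n, rfl⟩) (by decide) ?_
      (FinitelySeparable.of_surjective hK g hg) ?_
    · obtain ⟨S, hS⟩ := hfg
      refine ⟨S.image g, ?_⟩
      rw [Finset.coe_image, ← NonUnitalRingHom.map_closure, hS]
      exact (NonUnitalRingHom.range_eq_map g).symm.trans (NonUnitalRingHom.range_eq_top.2 hg)
    · intro n x hn hx
      obtain ⟨y, rfl⟩ := hg x
      rw [← map_nsmul, hg0, ← mul_smul] at hx
      exact (hg0 y).2 (htors y (m * n) (mul_ne_zero hm hn) hx)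
  have hker : torsionAddSubgroup K m = (g : K →+ f.range).ker := by
    ext x
    exact (hg0 x).symm
  rw [hker]
  let e := QuotientAddGroup.quotientKerEquivOfSurjective (g : K →+ f.range) hg
  have := Module.Finite.iff_addGroup_fg.1 hfin
  exact AddGroup.fg_of_surjective (f := e.symm.toAddMonoidHom) e.symm.surjective

theorem fg_range_of_dvd_pow [Countable (Ideal (Dorroh B K))]
    (hB : Function.Surjective (Int.cast : ℤ → B))  (hK : FinitelySeparable K)
    {k m d : ℕ} (hm : m ≠ 0) (hkm : k ∣ m) (hmk : m ∣ k ^ d)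
    (hr : (nsmulAddMonoidHom (α := K) m).range.FG) :
    (nsmulAddMonoidHom (α := K) k).range.FG := by
  have hI : ∃ I : Ideal (Dorroh B K), ∀ u, u ∈ I ↔ u ∈ inrRange B K ∧ (m : Dorroh B K) * u = 0 :=
    ⟨inrRange B K ⊓ LinearMap.ker (LinearMap.lsmul _ _ (m : Dorroh B K)), fun u => Iff.rfl⟩
  obtain ⟨I, hI⟩ := hI
  set L := Ideal.span {(k : Dorroh B K)} * I with hL
  have hLfin : (L : Set (Dorroh B K)).Finite := by
    refine finite_ideal_of_pow_eq_bot hB hK hm d (Ideal.mul_le_right.trans fun u hu => ((hI u).1 hu).1)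
      ?_ ?_
    · rw [eq_bot_iff]
      intro u hu
      obtain ⟨v, hv, rfl⟩ := Ideal.mem_span_singleton_mul.1 hu
      exact ((hI v).1 (Ideal.mul_le_right hv)).2
    · rw [eq_bot_iff, hL, mul_pow, Ideal.span_singleton_pow]
      intro u hu
      obtain ⟨v, hv, rfl⟩ := Ideal.mem_span_singleton_mul.1 hu
      have h1 := ((hI v).1 (Ideal.pow_le_self (pow_ne_zero _ two_ne_zero) hv)).2
      obtain ⟨c, hc⟩ := hmk.trans (pow_dvd_pow k Nat.lt_two_pow_self.le)
      rw [← Nat.cast_pow, hc, Nat.cast_mul, mul_right_comm, h1, zero_mul]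
      exact Ideal.zero_mem _
  obtain ⟨e, rfl⟩ := hkm
  have key : (AddSubgroup.toIntSubmodule (nsmulAddMonoidHom (α := K) k).range).FG := by
    refine Submodule.fg_of_fg_map_of_fg_inf_ker (nsmulAddMonoidHom (α := K) e).toIntLinearMap ?_ ?_
    · have hmap : Submodule.map (nsmulAddMonoidHom (α := K) e).toIntLinearMap
          (AddSubgroup.toIntSubmodule (nsmulAddMonoidHom (α := K) k).range) =
          AddSubgroup.toIntSubmodule (nsmulAddMonoidHom (α := K) (k * e)).range := by
        ext x
        constructor
        · rintro ⟨_, ⟨y, rfl⟩, rfl⟩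
          exact ⟨y, mul_nsmul _ _ _⟩
        · rintro ⟨y, rfl⟩
          exact ⟨_, ⟨y, rfl⟩, (mul_nsmul _ _ _).symm⟩
      rw [hmap]
      exact (Submodule.fg_iff_addSubgroup_fg _).2 hr
    · have hfin : ((AddSubgroup.toIntSubmodule (nsmulAddMonoidHom (α := K) k).range ⊓
          LinearMap.ker (nsmulAddMonoidHom (α := K) e).toIntLinearMap : Submodule ℤ K) :
            Set K).Finite := by
        refine (hLfin.image Dorroh.snd).subset ?_
        rintro _ ⟨⟨y, rfl⟩, hy⟩
        refine ⟨Dorroh.inr (k • y), Ideal.mem_span_singleton_mul.2 ⟨Dorroh.inr y, (hI _).2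
          ⟨inr_mem_inrRange y, ?_⟩, natCast_mul_inr k y⟩, rfl⟩
        have h0 : e • k • y = 0 := hy
        rw [natCast_mul_inr, mul_comm, mul_smul, h0, map_zero]
      exact ⟨hfin.toFinset, by rw [Set.Finite.coe_toFinset]; exact Submodule.span_eq _⟩
  exact (Submodule.fg_iff_addSubgroup_fg _).1 key

theorem exists_squarefree_fg_range
    (hfg : ∃ S : Finset K, NonUnitalSubring.closure (S : Set K) = ⊤) (hK : FinitelySeparable K) :
    ∃ k : ℕ, Squarefree k ∧ (nsmulAddMonoidHom (α := K) k).range.FG := by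
  have hB : Function.Surjective (Int.cast : ℤ → ℤ) := fun n => ⟨n, rfl⟩
  obtain ⟨-, _, _⟩ := noetherian_countable_dorroh (B := ℤ) (K := K) hB hfg
  obtain ⟨m, hm, hb⟩ := exists_torsion_bound (Dorroh ℤ K)
  have hr := fg_range_of_torsion_bound hfg hK hm.ne' (fun x n hn h => by
    have := hb (Dorroh.inr x) n (Nat.pos_of_ne_zero hn) (by rw [natCast_mul_inr, h, map_zero])
    rw [natCast_mul_inr, ← map_zero Dorroh.inr] at this
    exact Dorroh.inr_injective this)
  obtain ⟨k, d, hk, hkm, hd⟩ := exists_squarefree_dvd_pow_of_ne_zero hm.ne'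
  exact ⟨k, hk, fg_range_of_dvd_pow hB hK hm.ne' hkm hd hr⟩

end TorsionQuotient

section Decomposition

theorem finiteType_int (B : Type*) {U : Type*} [CommRing B] [CommRing U] [Algebra B U]
    (hB : Function.Surjective (Int.cast : ℤ → B)) [h : Algebra.FiniteType B U] :
    Algebra.FiniteType ℤ U := by
  have h1 : Algebra.FiniteType ℤ B := by
    refine Algebra.FiniteType.of_surjective (Algebra.ofId ℤ B) ?_
    intro b
    obtain ⟨n, rfl⟩ := hB b
    exact ⟨n, by simp⟩
  exact h1.trans h

theorem exists_finite_quotient_forall_notMem {U : Type*} [CommRing U] [Algebra.FiniteType ℤ U]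
    (M : Ideal U) {T : Set U} (hT : T.Finite) (h : ∀ t ∈ T, t ∉ M) :
    ∃ J : Ideal U, M ≤ J ∧ Finite (U ⧸ J) ∧ ∀ t ∈ T, t ∉ J := by
  induction T, hT using Set.Finite.induction_on with
  | empty =>
    exact ⟨⊤, le_top, Finite.of_subsingleton, by simp⟩
  | @insert a s ha hs ih =>
    obtain ⟨J, hMJ, hJ, hJs⟩ := ih fun t ht => h t (Set.mem_insert_of_mem _ ht)
    obtain ⟨J', hMJ', hJ', hJa⟩ := exists_finite_quotient_of_notMem (R := U)
      (h a (Set.mem_insert _ _))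
    refine ⟨J ⊓ J', le_inf hMJ hMJ', ?_, ?_⟩
    · exact CoveredMod.finite_quotient ((coveredMod_of_finite_quotient J Set.univ).inf
        (Y := J.toAddSubgroup) (Z := Submodule.toAddSubgroup J')
        (coveredMod_of_finite_quotient J' Set.univ))
    · rintro t (rfl | ht)
      · exact fun h => hJa h.2
      · exact fun h => hJs t ht h.1

theorem exists_small_range {A : Type*} {C : Type*} [NonUnitalCommRing A] [Countable A]
    [CommRing C] (f : A →ₙ+* C) :
    ∃ (R : Type) (_ : NonUnitalCommRing R) (g : A →ₙ+* R), Function.Surjective g ∧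
      ∀ x, g x = 0 ↔ f x = 0 := by
  have _ : Countable f.range := f.rangeRestrict_surjective.countable
  refine ⟨Shrink.{0} f.range, inferInstance,
    (NonUnitalRingHomClass.toNonUnitalRingHom (Shrink.ringEquiv.{0} f.range).symm).comp f.rangeRestrict,
    ?_, fun x => ?_⟩
  · exact (Shrink.ringEquiv.{0} f.range).symm.surjective.comp f.rangeRestrict_surjective
  · refine (map_eq_zero_iff _ (Shrink.ringEquiv.{0} f.range).symm.injective).trans ?_
    exact Subtype.ext_iff

theorem exists_prime_dvd_mem {U : Type*} [CommRing U] {P : Ideal U} [hP : P.IsPrime] {k : ℕ}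
    (hk : k ≠ 0) (h : (k : U) ∈ P) : ∃ q : ℕ, q.Prime ∧ (q : U) ∈ P := by
  induction k using induction_on_primes with
  | zero => exact (hk rfl).elim
  | one => exact (hP.one_notMem (by simpa using h)).elim
  | prime_mul p a hp ih =>
    rw [Nat.cast_mul] at h
    rcases hP.mem_or_mem h with h | h
    · exact ⟨p, hp, h⟩
    · exact ih (right_ne_zero_of_mul hk) h

variable {B K : Type*} [CommRing B] [NonUnitalCommRing K] [Module B K] [IsScalarTower B K K]
  [SMulCommClass B K K]

theorem exists_subdirect_decomposition [IsNoetherianRing B]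
    (hB : Function.Surjective (Int.cast : ℤ → B))
    (hfg : ∃ S : Finset K, NonUnitalSubring.closure (S : Set K) = ⊤) (hK : FinitelySeparable K)
    {k : ℕ} (hk : k ≠ 0) :
    ∃ (F : Type) (_ : NonUnitalCommRing F) (_ : Finite F) (n : ℕ) (R : Fin n → Type)
      (_ : ∀ i, NonUnitalCommRing (R i)) (q : Fin n → ℕ) (ψ : torsionSubring K k →ₙ+* F)
      (χ : ∀ i, torsionSubring K k →ₙ+* R i), Function.Surjective ψ ∧
      (∀ i, Function.Surjective (χ i)) ∧ (∀ i, (q i).Prime) ∧ (∀ i, ∀ c : R i, q i • c = 0) ∧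
      (∀ i, ∀ x y : R i, x ≠ 0 → y ≠ 0 → x * y ≠ 0) ∧
      ∀ x, ψ x = 0 → (∀ i, χ i x = 0) → x = 0 := by
  obtain ⟨hft, hN, hIc⟩ := noetherian_countable_dorroh (B := B) (K := K) hB hfg
  have _ : Countable B := hB.countable
  have hft' : Algebra.FiniteType ℤ (Dorroh B K) := finiteType_int B hB
  have hUc : Countable (Dorroh B K) := countable_of_finiteType B
  have _ : Countable K := (Dorroh.inr_injective (B := B) (K := K)).countable
  have _ : Countable (torsionSubring K k) := Subtype.val_injective.countable
  have hI : ∃ I : Ideal (Dorroh B K), I ≤ inrRange B K ∧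
      ∀ u, u ∈ I ↔ u ∈ inrRange B K ∧ (k : Dorroh B K) * u = 0 :=
    ⟨inrRange B K ⊓ LinearMap.ker (LinearMap.lsmul _ _ (k : Dorroh B K)), inf_le_left,
      fun u => Iff.rfl⟩
  obtain ⟨I, hIκ, hI⟩ := hI
  let ι : torsionSubring K k →ₙ+* Dorroh B K :=
    Dorroh.inr.comp (NonUnitalSubringClass.subtype (torsionSubring K k))
  have hι : Function.Injective ι := Dorroh.inr_injective.comp Subtype.val_injective
  have hιI : ∀ x, ι x ∈ I := fun x => (hI _).2 ⟨inr_mem_inrRange _, by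
    have : k • (x : K) = 0 := x.2
    change (k : Dorroh B K) * Dorroh.inr (x : K) = 0
    rw [natCast_mul_inr, this, map_zero]⟩
  obtain ⟨d, hd⟩ := IsNoetherianRing.isNilpotent_nilradical (Dorroh B K)
  set N := I ⊓ nilradical (Dorroh B K) with hNdef
  have hNfin : (N : Set (Dorroh B K)).Finite := by
    refine finite_ideal_of_pow_eq_bot hB hK hk d (inf_le_left.trans hIκ) ?_ ?_
    · rw [eq_bot_iff]
      intro u hu
      obtain ⟨v, hv, rfl⟩ := Ideal.mem_span_singleton_mul.1 hu
      exact ((hI v).1 hv.1).2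
    · rw [eq_bot_iff]
      refine (Ideal.pow_right_mono inf_le_right _).trans ?_
      refine (Ideal.pow_le_pow_right Nat.lt_two_pow_self.le).trans ?_
      rw [hd]
      exact le_rfl
  obtain ⟨J, -, hJ, hJN⟩ := exists_finite_quotient_forall_notMem (⊥ : Ideal (Dorroh B K))
    (hNfin.subset (Set.sdiff_subset (t := {0}))) (fun t ht => ht.2)
  obtain ⟨F, hF, ψ, hψ, hψ0⟩ :=
    exists_small_range ((Ideal.Quotient.mk J).toNonUnitalRingHom.comp ι)
  have hmin := minimalPrimes.finite_of_isNoetherianRing (Dorroh B K)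
  have _ := hmin.to_subtype
  obtain ⟨n, ⟨e⟩⟩ := Finite.exists_equiv_fin (minimalPrimes (Dorroh B K))
  choose R hR χ hχ hχ0 using fun i : Fin n => exists_small_range
    ((Ideal.Quotient.mk (e.symm i : Ideal (Dorroh B K))).toNonUnitalRingHom.comp ι)
  have hψ1 : ∀ x, ψ x = 0 ↔ ι x ∈ J := fun x => (hψ0 x).trans Ideal.Quotient.eq_zero_iff_mem
  have hχ1 : ∀ i x, χ i x = 0 ↔ ι x ∈ (e.symm i : Ideal (Dorroh B K)) := fun i x =>
    (hχ0 i x).trans Ideal.Quotient.eq_zero_iff_mem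
  have hprime : ∀ i, (e.symm i : Ideal (Dorroh B K)).IsPrime := fun i => (e.symm i).2.1.1
  have hq : ∀ i, ∃ q : ℕ, q.Prime ∧ ∀ x, χ i (q • x) = 0 := by
    intro i
    by_cases h : ∀ x, χ i x = 0
    · exact ⟨2, Nat.prime_two, fun x => h _⟩
    · push Not at h
      obtain ⟨x, hx⟩ := h
      rw [Ne, hχ1] at hx
      have := hprime i
      obtain ⟨q, hq, hqm⟩ := exists_prime_dvd_mem (P := (e.symm i : Ideal (Dorroh B K))) hk
        (((hprime i).mem_or_mem (x := (k : Dorroh B K)) (y := ι x) (by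
          rw [((hI _).1 (hιI x)).2]; exact Ideal.zero_mem _)).resolve_right hx)
      refine ⟨q, hq, fun x => (hχ1 i _).2 ?_⟩
      rw [map_nsmul, nsmul_eq_mul]
      exact Ideal.mul_mem_right _ _ hqm
  choose q hq hq0 using hq
  refine ⟨F, hF, ?_, n, R, hR, q, ψ, χ, hψ, hχ, hq, ?_, ?_, ?_⟩
  · have hinj : ∀ x y, ι x - ι y ∈ J → ψ x = ψ y := fun x y h => by
      rw [← sub_eq_zero, ← map_sub, hψ1, map_sub]
      exact h
    refine Finite.of_injective (fun y : F => Ideal.Quotient.mk J (ι (Function.surjInv hψ y)))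
      fun y z hyz => ?_
    have := hinj _ _ (Ideal.Quotient.eq.1 hyz)
    rwa [Function.surjInv_eq hψ, Function.surjInv_eq hψ] at this
  · intro i c
    obtain ⟨x, rfl⟩ := hχ i c
    rw [← map_nsmul, hq0]
  · intro i x y hx hy
    obtain ⟨x, rfl⟩ := hχ i x
    obtain ⟨y, rfl⟩ := hχ i y
    rw [← map_mul, Ne, hχ1, map_mul]
    rw [Ne, hχ1] at hx hy
    exact fun h => ((hprime i).mem_or_mem h).elim hx hy
  · intro x h1 h2
    rw [hψ1] at h1
    have h3 : ι x ∈ nilradical (Dorroh B K) := by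
      rw [nilradical, ← Ideal.sInf_minimalPrimes, Submodule.mem_sInf]
      intro P hP
      have := (hχ1 (e ⟨P, hP⟩) x).1 (h2 _)
      rwa [Equiv.symm_apply_apply] at this
    by_contra hx
    exact hJN (ι x) ⟨⟨hιI x, h3⟩, fun h0 => hx (hι (by rw [map_zero]; exact h0))⟩ h1

end Decomposition

section

theorem exists_subdirect_product_of_finitelySeparable {K : Type*} [NonUnitalCommRing K]
    (hfg : ∃ S : Finset K, NonUnitalSubring.closure (S : Set K) = ⊤) (hK : FinitelySeparable K) :
    ∃ k : ℕ, Squarefree k ∧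
      AddGroup.FG (K ⧸ torsionAddSubgroup K k) ∧
      ∃ (F : Type) (_ : NonUnitalRing F) (_ : Finite F)
        (n : ℕ) (R : Fin n → Type) (_ : ∀ i, NonUnitalRing (R i)) (q : Fin n → ℕ),
        (∀ i, (q i).Prime) ∧
        (∀ i, ∀ c : R i, q i • c = 0) ∧
        (∀ i, ∀ x y : R i, x ≠ 0 → y ≠ 0 → x * y ≠ 0) ∧
        (∀ i, ∀ a b : R i, IsTranscendentalElt (q i) a → IsTranscendentalElt (q i) b →
          IntegrallyDependent (q i) a b) ∧
        ∃ φ : torsionSubring K k →ₙ+* F × (∀ i, R i),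
          Function.Injective φ ∧
          Function.Surjective (fun x => (φ x).1) ∧
          (∀ i, Function.Surjective (fun x => (φ x).2 i)) := by
  obtain ⟨k, hk, hr⟩ := exists_squarefree_fg_range hfg hK
  obtain ⟨F, hF, hFfin, n, R, hR, q, ψ, χ, hψ, hχ, hq, hq0, hdom, hinj⟩ :=
    exists_subdirect_decomposition (B := ℤ) (fun n => ⟨n, rfl⟩) hfg hK hk.ne_zero
  refine ⟨k, hk, (fg_quotient_torsion_iff k).2 hr, F, inferInstance, hFfin, n, R,
    fun i => inferInstance, q, hq, hq0, hdom, fun i a b ha hb => ?_,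
    ψ.prod (NonUnitalRingHom.pi χ), ?_, hψ, hχ⟩
  · exact integrallyDependent_of_finitelySeparable (hq i) (hq0 i) (hdom i)
      (FinitelySeparable.of_surjective
        (FinitelySeparable.of_injective hK (NonUnitalSubringClass.subtype (torsionSubring K k))
          Subtype.val_injective) (χ i) (hχ i)) ha hb
  · rw [injective_iff_map_eq_zero]
    intro x hx
    exact hinj x (congrArg Prod.fst hx) fun i => congrFun (congrArg Prod.snd hx) i

end

section

theorem exists_nsmul_notMem {V : Type*} [AddCommGroup V] (L : AddSubgroup V) {k : ℕ} (hk : k ≠ 0)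
    (hfg : (nsmulAddMonoidHom (α := V) k).range.FG) {a : V} (ha : a ∉ L) :
    ∃ n : ℕ, n ≠ 0 ∧ a ∉ L ⊔ (nsmulAddMonoidHom (α := V) n).range := by
  by_contra! hcon
  let D := (nsmulAddMonoidHom (α := V) k).range.map (QuotientAddGroup.mk' L)
  have : AddGroup.FG (nsmulAddMonoidHom (α := V) k).range :=
    (AddGroup.fg_iff_addSubgroup_fg _).2 hfg
  have : AddGroup.FG D := AddGroup.fg_of_surjective
    (AddMonoidHom.addSubgroupMap_surjective (QuotientAddGroup.mk' L) _)
  have : Module.Finite ℤ D := Module.Finite.iff_addGroup_fg.2 this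
  have hmem : ∀ n : ℕ, n ≠ 0 → ∃ v : V, QuotientAddGroup.mk' L (n • v) =
      QuotientAddGroup.mk' L a := by
    intro n hn
    obtain ⟨y, hy, z, ⟨v, hv⟩, hyz⟩ := AddSubgroup.mem_sup.1 (hcon n hn)
    refine ⟨v, ?_⟩
    have hy0 : QuotientAddGroup.mk' L y = 0 := (QuotientAddGroup.eq_zero_iff y).2 hy
    rw [← hyz, map_add, hy0, zero_add, ← hv]
    rfl
  obtain ⟨v₀, hv₀⟩ := hmem k hk
  let x : D := ⟨QuotientAddGroup.mk' L a, k • v₀, ⟨v₀, rfl⟩, hv₀⟩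
  have hx : x ≠ 0 := fun h =>
    ha ((QuotientAddGroup.eq_zero_iff a).1 (congrArg Subtype.val h))
  obtain ⟨N, hN, hxN⟩ := exists_finite_quotient_notMem (R := ℤ) hx
  let c := Nat.card (D ⧸ N)
  have hc : c ≠ 0 := Nat.card_pos.ne'
  obtain ⟨v, hv⟩ := hmem (c * k) (mul_ne_zero hc hk)
  let w : D := ⟨QuotientAddGroup.mk' L (k • v), k • v, ⟨v, rfl⟩, rfl⟩
  have hw : c • w = x := by
    refine Subtype.ext ?_
    change c • QuotientAddGroup.mk' L (k • v) = _
    rw [← map_nsmul, ← mul_smul, hv]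
  refine hxN (hw ▸ (Submodule.Quotient.mk_eq_zero N).1 ?_)
  rw [Submodule.Quotient.mk_smul]
  exact card_nsmul_eq_zero'

theorem coveredMod_nsmul_of_fg {V : Type*} [AddCommGroup V] {H : AddSubgroup V}
    (hH : H.FG) {n : ℕ} (hn : n ≠ 0) :
    CoveredMod (H : Set V) ((nsmulAddMonoidHom (α := V) n).range : Set V) := by
  have := (AddGroup.fg_iff_addSubgroup_fg H).2 hH
  have : Module.Finite ℤ H := Module.Finite.iff_addGroup_fg.2 this
  let N : Submodule ℤ H := LinearMap.range (LinearMap.lsmul ℤ H (n : ℤ))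
  have : Finite (H ⧸ N) := by
    refine Module.finite_of_fg_torsion _ fun {x} => ?_
    obtain ⟨y, rfl⟩ := N.mkQ_surjective x
    refine ⟨⟨n, mem_nonZeroDivisors_of_ne_zero (by exact_mod_cast hn)⟩, ?_⟩
    change (n : ℤ) • N.mkQ y = 0
    rw [← map_smul]
    exact (Submodule.Quotient.mk_eq_zero N).2 ⟨y, rfl⟩
  obtain ⟨T, hT, -, h⟩ := coveredMod_of_finite_quotient N Set.univ
  refine coveredMod_of_finite (hT.image Subtype.val) fun x hx => ?_
  obtain ⟨t, ht, z, hz⟩ := h ⟨x, hx⟩ trivial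
  refine ⟨t, ⟨t, ht, rfl⟩, z, ?_⟩
  have := congrArg Subtype.val hz
  simpa using this

theorem exists_finite_quotient_forall_sub_notMem {U : Type*} [CommRing U] [Algebra.FiniteType ℤ U]
    {k : ℕ} (hk : k ≠ 0) (hfg : (nsmulAddMonoidHom (α := U) k).range.FG)
    {A H : AddSubgroup U} {W : Ideal U} (hH : H.FG) (hHA : H ≤ A) (hA : A ≤ H ⊔ W.toAddSubgroup)
    {a : U} (ha : a ∉ A ⊔ W.toAddSubgroup) :
    ∃ J : Ideal U, Finite (U ⧸ J) ∧ ∀ x ∈ A, a - x ∉ J := by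
  obtain ⟨n, hn, han⟩ := exists_nsmul_notMem _ hk hfg ha
  let W' : Ideal U := W ⊔ Ideal.span {(n : U)}
  have hW' : ∀ x ∈ W', x ∈ W.toAddSubgroup ⊔ (nsmulAddMonoidHom (α := U) n).range := by
    intro x hx
    obtain ⟨y, hy, z, hz, rfl⟩ := Submodule.mem_sup.1 hx
    obtain ⟨v, rfl⟩ := Ideal.mem_span_singleton'.1 hz
    refine AddSubgroup.add_mem_sup hy ⟨v, ?_⟩
    simp [nsmul_eq_mul, mul_comm]
  obtain ⟨T, hT, hTH, hcov⟩ := coveredMod_nsmul_of_fg hH hn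
  obtain ⟨J, hWJ, hJ, hTJ⟩ := exists_finite_quotient_forall_notMem W' (hT.image (fun t => a - t)) (by
    rintro _ ⟨t, ht, rfl⟩ hat
    refine han ?_
    have h1 := AddSubgroup.mem_sup.1 (hW' _ hat)
    obtain ⟨y, hy, z, hz, hyz⟩ := h1
    have h2 : a = t + y + z := by rw [add_assoc, hyz, add_sub_cancel]
    rw [h2]
    exact AddSubgroup.add_mem_sup (AddSubgroup.add_mem_sup (hHA (hTH ht)) hy) hz)
  refine ⟨J, hJ, fun x hx hxJ => ?_⟩
  obtain ⟨y, hy, w, hw, rfl⟩ := AddSubgroup.mem_sup.1 (hA hx)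
  obtain ⟨t, ht, v, hv⟩ := hcov y hy
  refine hTJ _ ⟨t, ht, rfl⟩ ?_
  have hvJ : y - t ∈ J := by
    refine hWJ (Ideal.mem_sup_right (Ideal.mem_span_singleton'.2 ⟨v, ?_⟩))
    rw [← hv]
    simp [nsmul_eq_mul, mul_comm]
  have hwJ : w ∈ J := hWJ (Ideal.mem_sup_left hw)
  have : a - t = (a - (y + w)) + (y - t) + w := by abel
  change a - t ∈ J
  rw [this]
  exact J.add_mem (J.add_mem hxJ hvJ) hwJ

end

section

theorem isIntegral_of_isIntegral_adjoin {S B : Type*} [CommRing S] [CommRing B] [Algebra S B]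
    {s : Set B} {x : B} (hs : ∀ y ∈ s, IsIntegral S y)
    (hx : IsIntegral (Algebra.adjoin ℤ s) x) : IsIntegral S x := by
  let D := integralClosure S B
  have hle : ∀ y ∈ Algebra.adjoin ℤ s, y ∈ D := by
    intro y hy
    induction hy using Algebra.adjoin_induction with
    | mem y hy => exact hs y hy
    | algebraMap r => simp
    | add y z _ _ hy hz => exact D.add_mem hy hz
    | mul y z _ _ hy hz => exact D.mul_mem hy hz
  let f : Algebra.adjoin ℤ s →+* D :=
    (Algebra.adjoin ℤ s).val.toRingHom.codRestrict D fun y => hle y y.2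
  have : IsIntegral D (RingHom.id B x) := IsIntegral.map_of_comp_eq f (RingHom.id B) rfl hx
  exact isIntegral_trans (A := D) x this

theorem exists_pow_eq_pow_of_isIntegral {R : Type*} [CommRing R] {p : ℕ} (hp : p ≠ 0)
    (hpR : (p : R) = 0) {x : R} (hx : IsIntegral ℤ x) : ∃ i j, i < j ∧ x ^ i = x ^ j := by
  let D := Algebra.adjoin ℤ {x}
  have hfg : Module.Finite ℤ D := Module.Finite.iff_fg.2 hx.fg_adjoin_singleton
  have : Finite D := by
    refine Module.finite_of_fg_torsion D fun {y} => ?_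
    refine ⟨⟨p, mem_nonZeroDivisors_of_ne_zero (by exact_mod_cast hp)⟩, Subtype.ext ?_⟩
    change (((p : ℤ) • y : D) : R) = 0
    simp [hpR]
  let y : D := ⟨x, Algebra.subset_adjoin rfl⟩
  obtain ⟨i, j, hij, he⟩ := Finite.exists_ne_map_eq_of_infinite (fun n : ℕ => y ^ n)
  have he' : x ^ i = x ^ j := congrArg Subtype.val he
  rcases lt_or_gt_of_ne hij with h | h
  · exact ⟨i, j, h, he'⟩
  · exact ⟨j, i, h, he'.symm⟩

theorem exists_finite_quotient_of_isIntegral {U : Type*} [CommRing U] [Algebra.FiniteType ℤ U]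
    {P : Ideal U} (hP : P = ⊤ ∨ P.IsPrime) {p : ℕ} (hp : p ≠ 0) (hpP : (p : U) ∈ P) :
    ∃ m : Ideal U, Finite (U ⧸ m) ∧
      ∀ x ∈ m, IsIntegral ℤ (Ideal.Quotient.mk P x) → x ∈ P := by
  rcases hP with rfl | hP
  · exact ⟨⊤, inferInstance, fun x hx _ => hx⟩
  obtain ⟨m, hm, hle⟩ := Ideal.exists_le_maximal P hP.ne_top
  refine ⟨m, finite_quotient_of_isMaximal m, fun x hx h_int => ?_⟩
  obtain ⟨i, j, hij, he⟩ := exists_pow_eq_pow_of_isIntegral hp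
    (by rw [← map_natCast (Ideal.Quotient.mk P), Ideal.Quotient.eq_zero_iff_mem]; exact hpP) h_int
  rw [← map_pow, ← map_pow, Ideal.Quotient.eq] at he
  obtain ⟨d, rfl⟩ := Nat.exists_eq_add_of_lt hij
  have h1 : x ^ i * (1 - x ^ (d + 1)) ∈ P := by
    convert he using 1
    ring
  rcases hP.mem_or_mem h1 with h | h
  · exact hP.mem_of_pow_mem _ h
  · exfalso
    refine hm.ne_top ((Ideal.eq_top_iff_one _).2 ?_)
    have := m.add_mem (hle h) (Ideal.pow_mem_of_mem m hx (d + 1) d.succ_pos)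
    simpa using this

open Polynomial in
theorem exists_monic_aeval_mem {S U : Type*} [CommRing S] [CommRing U] [Algebra S U] {P : Ideal U}
    {x : U} (h : IsIntegral S (Ideal.Quotient.mk P x)) : ∃ G : S[X], G.Monic ∧ aeval x G ∈ P := by
  obtain ⟨G, hG, h0⟩ := h
  refine ⟨G, hG, Ideal.Quotient.eq_zero_iff_mem.1 ?_⟩
  rw [← h0, ← aeval_def, ← Ideal.Quotient.mkₐ_eq_mk S, aeval_algHom_apply]

open Polynomial in
theorem isIntegral_mk_of_forall_mul_mem {S U : Type*} [CommRing S] [CommRing U] [Algebra S U]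
    {ι : Type*} [Finite ι] {P : ι → Ideal U} {M : Ideal U} {x : U}
    (hx : ∀ i, IsIntegral S (Ideal.Quotient.mk (P i) x))
    (hM : ∀ u, (∀ i, x * u ∈ P i) → x * u ∈ M) : IsIntegral S (Ideal.Quotient.mk M x) := by
  have := Fintype.ofFinite ι
  nontriviality S
  choose G hG hGP using fun i => exists_monic_aeval_mem (hx i)
  have hmon : (X * ∏ i, G i).Monic := monic_X.mul (monic_prod_of_monic _ _ fun i _ => hG i)
  refine ⟨X * ∏ i, G i, hmon, ?_⟩
  rw [← aeval_def, ← Ideal.Quotient.mkₐ_eq_mk S, aeval_algHom_apply, Ideal.Quotient.mkₐ_eq_mk,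
    Ideal.Quotient.eq_zero_iff_mem, map_mul, aeval_X]
  refine hM _ fun i => Ideal.mul_mem_left _ _ ?_
  rw [map_prod]
  exact Ideal.mem_of_dvd _ (Finset.dvd_prod_of_mem _ (Finset.mem_univ i)) (hGP i)

open Polynomial in
theorem isIntegral_mk_of_finite {S U : Type*} [CommRing S] [CommRing U] [Algebra S U]
    {I M : Ideal U} [Module.Finite ℤ (U ⧸ I)]
    (hI : ∀ x ∈ I, IsIntegral S (Ideal.Quotient.mk M x)) (u : U) :
    IsIntegral S (Ideal.Quotient.mk M u) := by
  nontriviality S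
  obtain ⟨G, hG, hGI⟩ := exists_monic_aeval_mem
    (Algebra.IsIntegral.isIntegral (R := ℤ) (Ideal.Quotient.mk I u))
  have hmon : (X * G.map (Int.castRingHom S)).Monic := monic_X.mul (hG.map _)
  refine IsIntegral.of_aeval_monic hmon ?_ ?_
  · rw [monic_X.natDegree_mul (hG.map _), natDegree_X]
    omega
  · rw [← Ideal.Quotient.mkₐ_eq_mk S, aeval_algHom_apply]
    refine hI _ ?_
    rw [map_mul, aeval_X]
    refine I.mul_mem_left _ ?_
    have : aeval u (G.map (Int.castRingHom S)) = aeval u G := by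
      rw [aeval_def, eval₂_map, aeval_def]
      congr 1
      exact RingHom.ext_int _ _
    rwa [this]

end

section

theorem exists_fg_le_sup {V : Type*} [AddCommGroup V] {k : ℕ}
    (hfg : (nsmulAddMonoidHom (α := V) k).range.FG) {A N : AddSubgroup V}
    (hcov : CoveredMod {x | x ∈ A ∧ k • x = 0} (N : Set V)) :
    ∃ H : AddSubgroup V, H.FG ∧ H ≤ A ∧ A ≤ H ⊔ N := by
  classical
  let f := nsmulAddMonoidHom (α := V) k
  have hR : (AddSubgroup.toIntSubmodule f.range).FG := (Submodule.fg_iff_addSubgroup_fg _).2 hfg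
  have := isNoetherian_of_fg_of_noetherian _ hR
  have hL : (AddSubgroup.toIntSubmodule (A.map f)).FG :=
    isNoetherian_submodule.1 this _ fun x hx => by
      obtain ⟨y, -, rfl⟩ := hx
      exact ⟨y, rfl⟩
  obtain ⟨S, hS⟩ := (Submodule.fg_iff_addSubgroup_fg _).1 hL
  have hS' : AddSubgroup.closure (S : Set V) = A.map f := hS
  have hlift : ∀ s ∈ S, ∃ y ∈ A, f y = s := fun s hs => by
    have : s ∈ A.map f := hS' ▸ AddSubgroup.subset_closure hs
    exact this
  choose! g hgA hg using hlift
  obtain ⟨T, hT, hTA, hTN⟩ := hcov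
  refine ⟨AddSubgroup.closure (g '' S ∪ T), ⟨((S.finite_toSet.image g).union hT).toFinset, by simp⟩,
    ?_, fun x hx => ?_⟩
  · rw [AddSubgroup.closure_le]
    rintro _ (⟨s, hs, rfl⟩ | ht)
    · exact hgA s hs
    · exact (hTA ht).1
  · have h1 : A.map f ≤ (AddSubgroup.closure (g '' S)).map f := by
      rw [← hS', AddSubgroup.closure_le]
      intro s hs
      exact ⟨g s, AddSubgroup.subset_closure ⟨s, hs, rfl⟩, hg s hs⟩
    obtain ⟨h, hh, he⟩ := h1 ⟨x, hx, rfl⟩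
    have hhA : h ∈ A := by
      refine (AddSubgroup.closure_le A).2 ?_ hh
      rintro _ ⟨s, hs, rfl⟩
      exact hgA s hs
    obtain ⟨t, ht, hxt⟩ := hTN (x - h) ⟨A.sub_mem hx hhA, by
      change f (x - h) = 0
      rw [map_sub, he, sub_self]⟩
    have : x = (h + t) + (x - h - t) := by abel
    rw [this]
    exact AddSubgroup.add_mem_sup (add_mem (AddSubgroup.closure_mono Set.subset_union_left hh)
      (AddSubgroup.subset_closure (Or.inr ht))) hxt

theorem exists_ideal_coveredMod_of_isIntegral {U : Type*} [CommRing U] [Algebra.FiniteType ℤ U]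
    {N : Ideal U} {A : NonUnitalSubring U}
    (h_int : ∀ u : U, IsIntegral (Algebra.adjoin ℤ ((A : Set U) ∩ N))
      (Ideal.Quotient.mk (Module.annihilator U N) u))
    {n : U} (hn : n ∈ N) (hnA : n ∉ A) :
    ∃ W ≤ N, CoveredMod (N : Set U) (W : Set U) ∧ ∀ x ∈ A, x ∈ N → n - x ∉ W := by
  classical
  let Q := U ⧸ Module.annihilator U N
  let C := Algebra.adjoin ℤ ((A : Set U) ∩ N)
  let π : U →ₐ[ℤ] Q := Ideal.Quotient.mkₐ ℤ (Module.annihilator U N)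
  have hπ : Function.Surjective π := Ideal.Quotient.mk_surjective
  let S : Subalgebra ℤ Q := C.map π
  have : IsNoetherianRing U := Algebra.FiniteType.isNoetherianRing ℤ U
  have hQ : Algebra.FiniteType ℤ Q := Algebra.FiniteType.of_surjective π hπ
  have hSint : Algebra.IsIntegral S Q := ⟨fun y => by
    obtain ⟨u, rfl⟩ := hπ y
    let f : C →+* S := (π.toRingHom.comp C.val.toRingHom).codRestrict S
      fun c => ⟨c, c.2, rfl⟩
    exact IsIntegral.map_of_comp_eq f (RingHom.id Q) rfl (h_int u)⟩
  have hQS : Algebra.FiniteType S Q := Algebra.FiniteType.of_restrictScalars_finiteType ℤ S Q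
  have hfin : Module.Finite S Q := Algebra.IsIntegral.finite
  have hS : Algebra.FiniteType ℤ S :=
    ⟨fg_of_fg_of_fg ℤ S Q hQ.1 hfin.1 Subtype.val_injective⟩
  have hS' : @Algebra.FiniteType ℤ S _ _ (Ring.toIntAlgebra S) :=
    @finiteType_int ℤ S _ _ S.algebra (fun n => ⟨n, Int.cast_id⟩) hS
  let : Module Q N := Module.quotientAnnihilator
  have : IsScalarTower U Q N := ⟨fun a y x => by
    obtain ⟨b, rfl⟩ := Ideal.Quotient.mk_surjective y
    change (a • b) • x = a • b • x
    rw [smul_assoc]⟩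
  have : Module.Finite Q N := Module.Finite.of_restrictScalars_finite U Q N
  have : Module.Finite S N := Module.Finite.trans Q N
  let L : Submodule S N :=
    { carrier := {x | (x : U) ∈ A}
      add_mem' := fun hx hy => A.add_mem hx hy
      zero_mem' := A.zero_mem
      smul_mem' := by
        rintro ⟨_, c, hc, rfl⟩ x hx
        change c * (x : U) ∈ A
        have hc' : c ∈ Algebra.adjoin ℤ ((A : Set U) ∩ N) := hc
        have hx' : (x : U) ∈ A := hx
        generalize (x : U) = y at hx'
        clear hx hc
        induction hc' using Algebra.adjoin_induction generalizing y with
        | mem c hc => exact A.mul_mem hc.1 hx'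
        | algebraMap r => simpa using A.toAddSubgroup.zsmul_mem hx' r
        | add c d _ _ h1 h2 => rw [add_mul]; exact A.add_mem (h1 y hx') (h2 y hx')
        | mul c d _ _ h1 h2 => rw [mul_assoc]; exact h1 _ (h2 y hx') }
  obtain ⟨M, hLM, hM, hnM⟩ := exists_finite_quotient_of_notMem (N := L) (x := ⟨n, hn⟩) hnA
  obtain ⟨s, hs⟩ := hfin.1
  let W : Ideal U :=
    { carrier := {w | ∃ h : w ∈ N, ∀ y : Q, y • (⟨w, h⟩ : N) ∈ M}
      add_mem' := by
        rintro v w ⟨hv, hv'⟩ ⟨hw, hw'⟩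
        refine ⟨N.add_mem hv hw, fun y => ?_⟩
        have := M.add_mem (hv' y) (hw' y)
        rwa [← smul_add] at this
      zero_mem' := ⟨N.zero_mem, fun y => by
        have := M.zero_mem
        rwa [← smul_zero y] at this⟩
      smul_mem' := by
        rintro u w ⟨hw, hw'⟩
        refine ⟨N.mul_mem_left u hw, fun y => ?_⟩
        have := hw' (y * Ideal.Quotient.mk _ u)
        rwa [mul_smul] at this }
  refine ⟨W, fun w hw => hw.1, ?_, fun x hx hxN hW => hnM ?_⟩
  · refine coveredMod_of_map (γ := s → N ⧸ M)
      (fun x e => if h : x ∈ N then M.mkQ ((e : Q) • (⟨x, h⟩ : N)) else 0) ?_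
    intro x hx x' hx' he
    refine ⟨N.sub_mem hx hx', fun y => ?_⟩
    have hx0 : x ∈ N := hx
    have hx0' : x' ∈ N := hx'
    have key : ∀ e ∈ s, e • (⟨x - x', N.sub_mem hx hx'⟩ : N) ∈ M := by
      intro e hes
      have := congrFun he ⟨e, hes⟩
      simp only [hx0, hx0', dif_pos] at this
      have h2 := (Submodule.Quotient.eq M).1 this
      rwa [← smul_sub] at h2
    have hy : y ∈ Submodule.span S (s : Set Q) := hs ▸ Submodule.mem_top
    induction hy using Submodule.span_induction with
    | mem y hy => exact key y hy
    | zero => rw [zero_smul]; exact M.zero_mem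
    | add y z _ _ h1 h2 => rw [add_smul]; exact M.add_mem h1 h2
    | smul c y _ h1 => rw [smul_assoc]; exact M.smul_mem c h1
  · obtain ⟨h, hW'⟩ := hW
    have h1 := hW' 1
    rw [one_smul] at h1
    have h2 : (⟨x, hxN⟩ : N) ∈ M := hLM hx
    have := M.add_mem h1 h2
    convert this using 1
    exact Subtype.ext (by simp)

end

section

theorem finite_int_quotient_torsion {U : Type*} [CommRing U] {k : ℕ}
    (hfg : (nsmulAddMonoidHom (α := U) k).range.FG) {I : Ideal U}
    (hI : ∀ x, x ∈ I ↔ k • x = 0) : Module.Finite ℤ (U ⧸ I) := by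
  have : AddGroup.FG (U ⧸ torsionAddSubgroup U k) := (fg_quotient_torsion_iff k).2 hfg
  have h : torsionAddSubgroup U k = I.toAddSubgroup := AddSubgroup.ext fun x => (hI x).symm
  rw [h] at this
  exact Module.Finite.iff_addGroup_fg.2 this

theorem exists_finite_quotient_of_family {U : Type*} [CommRing U] [Algebra.FiniteType ℤ U]
    {k : ℕ} (hk : k ≠ 0) (hfg : (nsmulAddMonoidHom (α := U) k).range.FG)
    {ι : Type*} [Finite ι] {P : ι → Ideal U} {q : ι → ℕ} (hP : ∀ i, P i = ⊤ ∨ (P i).IsPrime)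
    (hq : ∀ i, q i ≠ 0) (hqP : ∀ i, (q i : U) ∈ P i)
    {G : AddSubgroup U} (hG : CoveredMod {x : U | k • x = 0} (G : Set U))
    (hGP : ∀ x ∈ G, ∀ y, k • x = 0 → k • y = 0 → (∀ i, x * y ∈ P i) → x * y = 0)
    (hdep : ∀ i x y, k • x = 0 → k • y = 0 → IsIntegral ℤ (Ideal.Quotient.mk (P i) y) ∨
      IsIntegral (Algebra.adjoin ℤ {Ideal.Quotient.mk (P i) y}) (Ideal.Quotient.mk (P i) x))
    {A : NonUnitalSubring U} {a : U} (ha : a ∉ A) :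
    ∃ J : Ideal U, Finite (U ⧸ J) ∧ ∀ x ∈ A, a - x ∉ J := by
  let I : Ideal U := LinearMap.ker (LinearMap.lsmul U U (k : U))
  have hI : ∀ x, x ∈ I ↔ k • x = 0 := fun x => by
    rw [nsmul_eq_mul]; rfl
  let Tr : ι → Prop := fun i => ∃ y ∈ A, k • y = 0 ∧ ¬ IsIntegral ℤ (Ideal.Quotient.mk (P i) y)
  let Q : Ideal U := I ⊓ ⨅ i : {i // Tr i}, P i
  have hQ : ∀ x, x ∈ Q ↔ k • x = 0 ∧ ∀ i, Tr i → x ∈ P i := fun x => by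
    simp [Q, hI]
  let N : Ideal U := I ⊓ Module.annihilator U Q
  have hN : ∀ x, x ∈ N ↔ k • x = 0 ∧ ∀ y ∈ Q, x * y = 0 := fun x => by
    simp only [N, Submodule.mem_inf, hI, Submodule.mem_annihilator, smul_eq_mul]
  have hQN : ∀ x ∈ Q, x ∈ Module.annihilator U N := fun x hx =>
    Submodule.mem_annihilator.2 fun y hy => by
      rw [smul_eq_mul, mul_comm]
      exact ((hN y).1 hy).2 x hx
  choose m hm hmP using fun i => exists_finite_quotient_of_isIntegral (hP i) (hq i) (hqP i)
  have hcovA : CoveredMod {x | x ∈ A ∧ k • x = 0} ((A : Set U) ∩ N) := by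
    have h1 : CoveredMod {x | x ∈ A ∧ k • x = 0} (G : Set U) := hG.subset fun x hx => hx.2
    have h2 : CoveredMod {x | x ∈ A ∧ k • x = 0}
        ((⨅ i, (m i).toAddSubgroup : AddSubgroup U) : Set U) := CoveredMod.iInf fun i => by
      have := hm i
      exact coveredMod_of_finite_quotient (m i) _
    obtain ⟨T, hT, hTA, h⟩ := h1.inf h2
    refine ⟨T, hT, hTA, fun x hx => ?_⟩
    obtain ⟨t, ht, hxG, hxm⟩ := h x hx
    refine ⟨t, ht, ?_⟩
    have hA : x - t ∈ A := A.sub_mem hx.1 (hTA ht).1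
    have h0 : k • (x - t) = 0 := by rw [smul_sub, hx.2, (hTA ht).2, sub_zero]
    refine ⟨hA, (hN _).2 ⟨h0, fun y hy => ?_⟩⟩
    rw [hQ] at hy
    refine hGP _ hxG y h0 hy.1 fun i => ?_
    by_cases hi : Tr i
    · exact (P i).mul_mem_left _ (hy.2 i hi)
    · refine (P i).mul_mem_right _ (hmP i _ ?_ ?_)
      · exact AddSubgroup.mem_iInf.1 hxm i
      · by_contra hnot
        exact hi ⟨_, hA, h0, hnot⟩
  obtain ⟨H, hH, hHA, hAH⟩ := exists_fg_le_sup (A := A.toAddSubgroup) (N := N.toAddSubgroup) hfg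
    (hcovA.mono Set.inter_subset_right)
  by_cases haN : a ∈ A.toAddSubgroup ⊔ N.toAddSubgroup
  swap
  · exact exists_finite_quotient_forall_sub_notMem hk hfg hH hHA hAH haN
  let S := Algebra.adjoin ℤ ((A : Set U) ∩ N)
  have hSA : ∀ c ∈ A, k • c = 0 → IsIntegral S c := by
    intro c hc hc0
    have hcov' : CoveredMod {x | x ∈ A ∧ k • x = 0}
        ((A.toAddSubgroup ⊓ N.toAddSubgroup : AddSubgroup U) : Set U) := hcovA
    obtain ⟨i, j, hij, he⟩ := hcov'.exists_sub_mem (fun n => c ^ (n + 1)) fun n => by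
      induction n with
      | zero => rw [zero_add, pow_one]; exact ⟨hc, hc0⟩
      | succ n ih =>
        rw [pow_succ]
        exact ⟨A.mul_mem ih.1 hc, by rw [← smul_mul_assoc, ih.2, zero_mul]⟩
    refine isIntegral_of_pow_sub_pow (Nat.succ_lt_succ hij) ?_
    exact isIntegral_algebraMap (R := S) (x := ⟨_, Algebra.subset_adjoin he⟩)
  have hSI : ∀ x ∈ I, IsIntegral S (Ideal.Quotient.mk (Module.annihilator U N) x) := by
    intro x hx
    have hx0 := (hI x).1 hx
    refine isIntegral_mk_of_forall_mul_mem (P := fun i : {i // Tr i} => P i) ?_ fun u hu => ?_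
    · rintro ⟨i, y, hy, hy0, hyi⟩
      refine isIntegral_of_isIntegral_adjoin ?_ ((hdep i x y hx0 hy0).resolve_left hyi)
      rintro _ rfl
      exact (hSA y hy hy0).map (Ideal.Quotient.mkₐ S (P i))
    · refine hQN _ ((hQ _).2 ⟨by rw [← smul_mul_assoc, hx0, zero_mul], fun i hi => hu ⟨i, hi⟩⟩)
  have := finite_int_quotient_torsion hfg hI
  have h_int := isIntegral_mk_of_finite hSI
  obtain ⟨b, hb, n, hn, hbn⟩ := AddSubgroup.mem_sup.1 haN
  have hnA : n ∉ A := fun h => ha (hbn ▸ A.add_mem hb h)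
  obtain ⟨W, hWN, hNW, hnW⟩ := exists_ideal_coveredMod_of_isIntegral h_int hn hnA
  have hcovW : CoveredMod ((A : Set U) ∩ N) (W.toAddSubgroup : Set U) :=
    CoveredMod.subset (Y := W.toAddSubgroup) hNW Set.inter_subset_right
  obtain ⟨H', hH', hHA', hAH'⟩ := exists_fg_le_sup (A := A.toAddSubgroup) (N := W.toAddSubgroup) hfg
    (hcovA.trans hcovW)
  refine exists_finite_quotient_forall_sub_notMem hk hfg hH' hHA' hAH' fun haW => ?_
  obtain ⟨c, hc, w, hw, hcw⟩ := AddSubgroup.mem_sup.1 haW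
  have hw' : n - (c - b) = w := by rw [sub_eq_iff_eq_add, ← add_right_inj b, hbn, ← hcw]; abel
  refine hnW (c - b) (A.sub_mem hc hb) ?_ (hw' ▸ hw)
  have : c - b = n - w := by rw [← hw', sub_sub_cancel]
  exact this ▸ N.sub_mem hn (hWN hw)

end

section

open MvPolynomial in
theorem finSuccEquiv_monic {p : ℕ} {f : MvPolynomial (Fin 2) (ZMod p)} (hf : MonicInVar f 0) :
    (finSuccEquiv (ZMod p) 1 f).Monic := by
  classical
  rw [Polynomial.Monic, Polynomial.leadingCoeff, natDegree_finSuccEquiv]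
  ext m
  rw [finSuccEquiv_coeff_coeff, coeff_one]
  have h0 : Finsupp.cons (f.degreeOf 0) (0 : Fin 1 →₀ ℕ) =
      Finsupp.single (0 : Fin 2) (f.degreeOf 0) := by
    ext i
    fin_cases i <;> simp [Finsupp.cons]
  split_ifs with hm
  · subst hm
    rw [h0]
    exact hf.1
  · by_contra hne
    have := hf.2 _ (mem_support_iff.2 hne) (Finsupp.cons_zero _ _)
    rw [← h0] at this
    have := congrArg Finsupp.tail this
    rw [Finsupp.tail_cons, Finsupp.tail_cons] at this
    exact hm this.symm

open MvPolynomial in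
theorem isIntegral_adjoin_of_monicInVar {p : ℕ} [NeZero p] {R : Type*} [CommRing R]
    [Algebra (ZMod p) R] {f : MvPolynomial (Fin 2) (ZMod p)} (hf : MonicInVar f 0) {x y : R}
    (h : aeval ![x, y] f = 0) : IsIntegral (Algebra.adjoin ℤ {y}) x := by
  let e : MvPolynomial (Fin 1) (ZMod p) →ₐ[ZMod p] R := aeval fun _ => y
  have he : ∀ g, e g ∈ Algebra.adjoin ℤ {y} := by
    intro g
    induction g using MvPolynomial.induction_on with
    | C a =>
      rw [algHom_C, ← ZMod.natCast_zmod_val a, map_natCast]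
      exact natCast_mem _ _
    | add g g' h1 h2 => rw [map_add]; exact add_mem h1 h2
    | mul_X g i h1 =>
      rw [map_mul]
      exact mul_mem h1 (by rw [aeval_X]; exact Algebra.subset_adjoin rfl)
  let e' : MvPolynomial (Fin 1) (ZMod p) →+* Algebra.adjoin ℤ {y} :=
    e.toRingHom.codRestrict (Algebra.adjoin ℤ {y}) he
  refine ⟨(finSuccEquiv (ZMod p) 1 f).map e', (finSuccEquiv_monic hf).map _, ?_⟩
  rw [Polynomial.eval₂_map]
  have key : ∀ g : MvPolynomial (Fin 2) (ZMod p), (finSuccEquiv (ZMod p) 1 g).eval₂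
      ((algebraMap (Algebra.adjoin ℤ {y}) R).comp e') x = aeval ![x, y] g := by
    intro g
    induction g using MvPolynomial.induction_on with
    | C a =>
      rw [algHom_C, ← algebraMap_eq, AlgEquiv.commutes, Polynomial.algebraMap_apply,
        Polynomial.eval₂_C]
      exact e.commutes a
    | add g g' h1 h2 => rw [map_add, Polynomial.eval₂_add, h1, h2, map_add]
    | mul_X g i h1 =>
      rw [map_mul, Polynomial.eval₂_mul, h1, map_mul, aeval_X]
      congr 1
      refine Fin.cases ?_ (fun j => ?_) i
      · simp [finSuccEquiv_X_zero]
      · rw [finSuccEquiv_X_succ, Polynomial.eval₂_C]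
        have : e (X j) = y := aeval_X _ _
        refine this.trans ?_
        fin_cases j
        rfl
  rw [key, h]

theorem isIntegral_int_of_aeval_eq_zero {p : ℕ} [Fact p.Prime] {R : Type*} [CommRing R]
    [Algebra (ZMod p) R] {f : Polynomial (ZMod p)} (hf : f ≠ 0) {x : R}
    (h : Polynomial.aeval x f = 0) : IsIntegral ℤ x := by
  have : Algebra.IsIntegral ℤ (ZMod p) := ⟨fun z => by
    obtain ⟨n, rfl⟩ := ZMod.intCast_surjective z
    exact isIntegral_algebraMap⟩
  exact isIntegral_trans (A := ZMod p) x (IsAlgebraic.isIntegral ⟨f, hf, h⟩)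

theorem charP_of_natCast_eq_zero {R : Type*} [Ring R] [Nontrivial R] {p : ℕ} (hp : p.Prime)
    (h : (p : R) = 0) : CharP R p := by
  obtain ⟨c, hc⟩ := CharP.exists R
  have hcp : c ∣ p := (CharP.cast_eq_zero_iff R c p).1 h
  rcases (Nat.dvd_prime hp).1 hcp with rfl | rfl
  · exact absurd rfl (CharP.char_ne_one R 1)
  · exact hc

theorem isIntegral_or_isIntegral_adjoin {T R Q : Type*} [NonUnitalCommRing T] [NonUnitalRing R]
    [CommRing Q] [IsDomain Q] {p : ℕ} (hp : p.Prime) (hpQ : (p : Q) = 0) (χ : T →ₙ+* R)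
    (g : T →ₙ+* Q) (hχg : ∀ t, χ t = 0 → g t = 0)
    (hdep : ∀ a b : R, IsTranscendentalElt p a → IsTranscendentalElt p b →
      IntegrallyDependent p a b) (x y : T) :
    IsIntegral ℤ (g y) ∨ IsIntegral (Algebra.adjoin ℤ {g y}) (g x) := by
  have : Fact p.Prime := ⟨hp⟩
  have := charP_of_natCast_eq_zero hp hpQ
  let := ZMod.algebra Q p
  have halg : ∀ t, ¬ IsTranscendentalElt p (χ t) → IsIntegral ℤ (g t) := by
    intro t ht
    simp only [IsTranscendentalElt, not_forall, not_not] at ht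
    obtain ⟨f, hf, hf0, hft⟩ := ht
    refine isIntegral_int_of_aeval_eq_zero hf ?_
    rw [← map_pEval g t hf0]
    exact hχg _ (by rw [map_pEval_eq, hft])
  by_cases hy : IsTranscendentalElt p (χ y)
  swap
  · exact Or.inl (halg y hy)
  right
  by_cases hx : IsTranscendentalElt p (χ x)
  swap
  · exact (halg x hx).tower_top
  obtain ⟨f, hf0, hf, -, hxy⟩ := hdep _ _ hx hy
  refine isIntegral_adjoin_of_monicInVar hf ?_
  rw [← map_mvEval g x y hf0]
  exact hχg _ (by rw [map_mvEval_eq, hxy])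

end

section

variable {B K : Type*} [CommRing B] [NonUnitalCommRing K] [Module B K] [IsScalarTower B K K]
  [SMulCommClass B K K]

theorem nsmul_dorroh_eq_zero_iff {k : ℕ} (hBk : ∀ b : B, k • b = 0 → b = 0) (u : Dorroh B K) :
    k • u = 0 ↔ ∃ x : torsionSubring K k, Dorroh.inr (x : K) = u := by
  constructor
  · intro h
    have h1 : Dorroh.fst u = 0 := hBk _ (by rw [← map_nsmul, h, map_zero])
    have h2 : k • Dorroh.snd u = 0 := by rw [← map_nsmul, h, map_zero]
    refine ⟨⟨Dorroh.snd u, h2⟩, ?_⟩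
    change Dorroh.inr (Dorroh.snd u) = u
    have := Dorroh.algebraMap_fst_add_inr_snd u
    rwa [h1, map_zero, zero_add] at this
  · rintro ⟨x, rfl⟩
    have : k • (x : K) = 0 := x.2
    rw [← map_nsmul, this, map_zero]

theorem fg_range_nsmul_dorroh (hB : Function.Surjective (Int.cast : ℤ → B)) {k : ℕ}
    (h : (nsmulAddMonoidHom (α := K) k).range.FG) :
    (nsmulAddMonoidHom (α := Dorroh B K) k).range.FG := by
  classical
  obtain ⟨S, hS⟩ := h
  refine ⟨insert (k : Dorroh B K) (S.image Dorroh.inr), ?_⟩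
  have hinr : ∀ x ∈ AddSubgroup.closure (S : Set K), (Dorroh.inr x : Dorroh B K) ∈
      AddSubgroup.closure (insert (k : Dorroh B K) (S.image Dorroh.inr) : Finset (Dorroh B K)) := by
    intro x hx
    induction hx using AddSubgroup.closure_induction with
    | mem x hx =>
      refine AddSubgroup.subset_closure ?_
      rw [Finset.coe_insert, Finset.coe_image]
      exact Or.inr ⟨x, hx, rfl⟩
    | zero => rw [map_zero]; exact zero_mem _
    | add x y _ _ h1 h2 => rw [map_add]; exact add_mem h1 h2
    | neg x _ h1 => rw [map_neg]; exact neg_mem h1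
  apply le_antisymm
  · rw [AddSubgroup.closure_le, Finset.coe_insert, Finset.coe_image]
    rintro _ (rfl | ⟨s, hs, rfl⟩)
    · exact ⟨1, by simp⟩
    · have : s ∈ (nsmulAddMonoidHom (α := K) k).range := hS ▸ AddSubgroup.subset_closure hs
      obtain ⟨v, rfl⟩ := this
      exact ⟨Dorroh.inr v, (map_nsmul _ _ _).symm⟩
  · rintro _ ⟨u, rfl⟩
    obtain ⟨n, hn⟩ := hB (Dorroh.fst u)
    have : nsmulAddMonoidHom k u = n • (k : Dorroh B K) + Dorroh.inr (k • Dorroh.snd u) := by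
      change k • u = _
      conv_lhs => rw [← Dorroh.algebraMap_fst_add_inr_snd u, smul_add, ← map_nsmul Dorroh.inr, ← hn]
      congr 1
      rw [map_intCast, nsmul_eq_mul, zsmul_eq_mul, mul_comm]
    rw [this]
    refine add_mem (zsmul_mem (AddSubgroup.subset_closure (by simp)) n) (hinr _ ?_)
    rw [hS]
    exact ⟨_, rfl⟩

theorem exists_ideal_of_torsionSubring_hom {k : ℕ} {R : Type*} [NonUnitalRing R]
    (hdom : ∀ x y : R, x ≠ 0 → y ≠ 0 → x * y ≠ 0) {q : ℕ} (hq : ∀ c : R, q • c = 0)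
    (χ : torsionSubring K k →ₙ+* R) :
    ∃ P : Ideal (Dorroh B K), (P = ⊤ ∨ P.IsPrime) ∧ (q : Dorroh B K) ∈ P ∧
      ∀ x : torsionSubring K k, Dorroh.inr (x : K) ∈ P ↔ χ x = 0 := by
  have hact : ∀ (u : Dorroh B K) (x : torsionSubring K k), ∃ z : torsionSubring K k,
      Dorroh.inr (z : K) = u * Dorroh.inr (x : K) := by
    intro u x
    have h1 : u * Dorroh.inr (x : K) ∈ inrRange B K :=
      Ideal.mul_mem_left _ _ (inr_mem_inrRange _)
    have h2 := exists_inr_of_mem h1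
    refine ⟨⟨Dorroh.snd (u * Dorroh.inr (x : K)), ?_⟩, h2⟩
    have hx : k • (x : K) = 0 := x.2
    change k • Dorroh.snd (u * Dorroh.inr (x : K)) = 0
    rw [← map_nsmul, ← mul_smul_comm, ← map_nsmul, hx, map_zero, mul_zero, map_zero]
  choose act hact using hact
  have heq : ∀ {z w : torsionSubring K k},
      (Dorroh.inr (z : K) : Dorroh B K) = Dorroh.inr (w : K) → z = w := fun h =>
    Subtype.ext (Dorroh.inr_injective h)
  have hsq : ∀ {c : R}, c * c = 0 → c = 0 := fun {c} h => by
    by_contra hc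
    exact hdom c c hc hc h
  let P : Ideal (Dorroh B K) :=
    { carrier := {u | ∀ x, χ (act u x) = 0}
      add_mem' := fun {u v} hu hv x => by
        have : act (u + v) x = act u x + act v x := heq (by
          simp [hact, add_mul])
        rw [this, map_add, hu, hv, add_zero]
      zero_mem' := fun x => by
        have : act 0 x = 0 := heq (by simp [hact])
        rw [this, map_zero]
      smul_mem' := fun u v hv x => by
        have : act (u • v) x = act v (act u x) := heq (by
          simp only [hact, smul_eq_mul]; ring)
        rw [this, hv] }
  have hP : ∀ u, u ∈ P ↔ ∀ x, χ (act u x) = 0 := fun u => Iff.rfl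
  refine ⟨P, ?_, (hP _).2 fun x => ?_, fun x => ⟨fun h => hsq ?_, fun h => (hP _).2 fun y => ?_⟩⟩
  · by_cases hT : P = ⊤
    · exact Or.inl hT
    refine Or.inr ⟨hT, fun {u v} huv => ?_⟩
    by_contra! hne
    simp only [hP, not_forall] at hne
    obtain ⟨⟨x, hx⟩, y, hy⟩ := hne
    refine hdom _ _ hx hy ?_
    have : act u x * act v y = act (u * v) (x * y) := heq (by
      simp [hact]; ring)
    rw [← map_mul, this, (hP _).1 huv]
  · have : act (q : Dorroh B K) x = q • x := heq (by
      rw [hact, natCast_mul_inr]; rfl)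
    rw [this, map_nsmul, hq]
  · have : act (Dorroh.inr (x : K)) x = x * x := heq (by simp [hact])
    rw [← map_mul, ← this]
    exact (hP _).1 h x
  · have : act (Dorroh.inr (x : K)) y = x * y := heq (by simp [hact])
    rw [this, map_mul, h, zero_mul]

end

section

variable {B K : Type*} [CommRing B] [NonUnitalCommRing K] [Module B K] [IsScalarTower B K K]
  [SMulCommClass B K K]

theorem finitelySeparable_of_family (hB : Function.Surjective (Int.cast : ℤ → B))
    {k : ℕ} (hBk : ∀ b : B, k • b = 0 → b = 0) (hk : k ≠ 0)
    (hfg : ∃ S : Finset K, NonUnitalSubring.closure (S : Set K) = ⊤)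
    (hfgk : (nsmulAddMonoidHom (α := K) k).range.FG)
    {F : Type*} [NonUnitalRing F] [Finite F] {ι : Type*} [Finite ι] {R : ι → Type*}
    [∀ i, NonUnitalRing (R i)] {q : ι → ℕ} (hq : ∀ i, (q i).Prime)
    (hqR : ∀ i, ∀ c : R i, q i • c = 0)
    (hdom : ∀ i, ∀ x y : R i, x ≠ 0 → y ≠ 0 → x * y ≠ 0)
    (hdep : ∀ i, ∀ a b : R i, IsTranscendentalElt (q i) a → IsTranscendentalElt (q i) b →
      IntegrallyDependent (q i) a b)
    (ψ : torsionSubring K k →ₙ+* F) (χ : ∀ i, torsionSubring K k →ₙ+* R i)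
    (hinj : ∀ x, ψ x = 0 → (∀ i, χ i x = 0) → x = 0) : FinitelySeparable K := by
  classical
  refine finitelySeparable_of_ideal B fun A a ha => ?_
  have : Algebra.FiniteType B (Dorroh B K) := finiteType_dorroh hfg
  have : Algebra.FiniteType ℤ (Dorroh B K) := finiteType_int B hB
  choose P hP hqP hχP using fun i =>
    exists_ideal_of_torsionSubring_hom (B := B) (hdom i) (hqR i) (χ i)
  have htor := nsmul_dorroh_eq_zero_iff (K := K) hBk
  let G : AddSubgroup (Dorroh B K) :=
    { carrier := {u | ∃ x : torsionSubring K k, ψ x = 0 ∧ Dorroh.inr (x : K) = u}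
      add_mem' := by
        rintro _ _ ⟨x, hx, rfl⟩ ⟨y, hy, rfl⟩
        exact ⟨x + y, by rw [map_add, hx, hy, add_zero], map_add _ _ _⟩
      zero_mem' := ⟨0, map_zero _, map_zero _⟩
      neg_mem' := by
        rintro _ ⟨x, hx, rfl⟩
        exact ⟨-x, by rw [map_neg, hx, neg_zero], map_neg _ _⟩ }
  let A' : NonUnitalSubring (Dorroh B K) := A.map Dorroh.inr
  have ha' : Dorroh.inr a ∉ A' := by
    rintro ⟨x, hx, he⟩
    exact ha (Dorroh.inr_injective he ▸ hx)
  have hG : CoveredMod {u : Dorroh B K | k • u = 0} (G : Set (Dorroh B K)) := by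
    refine coveredMod_of_map (γ := F)
      (fun u => if h : k • u = 0 then ψ ((htor u).1 h).choose else 0) fun u hu v hv he => ?_
    have hu0 : k • u = 0 := hu
    have hv0 : k • v = 0 := hv
    simp only [hu0, hv0, dif_pos] at he
    refine ⟨((htor u).1 hu0).choose - ((htor v).1 hv0).choose, by rw [map_sub, he, sub_self], ?_⟩
    rw [show (((((htor u).1 hu0).choose - ((htor v).1 hv0).choose : torsionSubring K k)) : K) =
      ((htor u).1 hu0).choose - ((htor v).1 hv0).choose from rfl, map_sub, ((htor u).1 hu0).choose_spec,
      ((htor v).1 hv0).choose_spec]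
  suffices h : ∃ J : Ideal (Dorroh B K), Finite (Dorroh B K ⧸ J) ∧
      ∀ x ∈ A', Dorroh.inr a - x ∉ J by
    obtain ⟨J, hJ, hJA⟩ := h
    refine ⟨J, hJ, fun x hx => ?_⟩
    rw [map_sub]
    exact hJA _ ⟨x, hx, rfl⟩
  refine exists_finite_quotient_of_family hk (fg_range_nsmul_dorroh hB hfgk) hP
    (fun i => (hq i).ne_zero) hqP hG ?_ ?_ ha'
  · rintro _ ⟨x, hx, rfl⟩ v - hv hmem
    obtain ⟨y, rfl⟩ := (htor v).1 hv
    have hxy : (Dorroh.inr (x : K) * Dorroh.inr (y : K) : Dorroh B K) =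
        Dorroh.inr ((x * y : torsionSubring K k) : K) := (map_mul _ _ _).symm
    have h0 : x * y = 0 := by
      refine hinj _ (by rw [map_mul, hx, zero_mul]) fun i => (hχP i _).1 ?_
      rw [← hxy]
      exact hmem i
    rw [hxy, h0]
    exact map_zero _
  · intro i u v hu hv
    obtain ⟨x, rfl⟩ := (htor u).1 hu
    obtain ⟨y, rfl⟩ := (htor v).1 hv
    rcases hP i with h | h
    · left
      have : Subsingleton (Dorroh B K ⧸ P i) := Ideal.Quotient.subsingleton_iff.2 h
      rw [Subsingleton.elim (Ideal.Quotient.mk (P i) _) 0]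
      exact isIntegral_zero
    · let g : torsionSubring K k →ₙ+* Dorroh B K ⧸ P i :=
        ((Ideal.Quotient.mk (P i)).toNonUnitalRingHom.comp Dorroh.inr).comp
          (NonUnitalSubringClass.subtype (torsionSubring K k))
      refine isIntegral_or_isIntegral_adjoin (hq i) ?_ (χ i) g (fun t ht => ?_) (hdep i) x y
      · rw [← map_natCast (Ideal.Quotient.mk (P i)), Ideal.Quotient.eq_zero_iff_mem]
        exact hqP i
      · exact Ideal.Quotient.eq_zero_iff_mem.2 ((hχP i t).2 ht)

end

end FinSep

/-- A finitely generated commutative (not necessarily unital) ring `K` is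
finitely separable if and only if there is a squarefree natural number `k` such that `K` is a
finite extension of its torsion ideal `I_k` (the additive group of `K / I_k` is finitely
generated) and `I_k` is a subdirect product of a finite ring and a finite collection of rings
without zero divisors, each of prime characteristic, in each of which any two transcendental
elements are integrally dependent. -/
theorem stmt0 {K : Type*} [NonUnitalCommRing K]
    (hfg : ∃ S : Finset K, NonUnitalSubring.closure (S : Set K) = ⊤) :
    FinitelySeparable K ↔
      ∃ k : ℕ, Squarefree k ∧
        AddGroup.FG (K ⧸ torsionAddSubgroup K k) ∧
        ∃ (F : Type) (_ : NonUnitalRing F) (_ : Finite F)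
          (n : ℕ) (R : Fin n → Type) (_ : ∀ i, NonUnitalRing (R i)) (q : Fin n → ℕ),
          (∀ i, (q i).Prime) ∧
          (∀ i, ∀ c : R i, q i • c = 0) ∧
          (∀ i, ∀ x y : R i, x ≠ 0 → y ≠ 0 → x * y ≠ 0) ∧
          (∀ i, ∀ a b : R i, IsTranscendentalElt (q i) a → IsTranscendentalElt (q i) b →
            IntegrallyDependent (q i) a b) ∧
          ∃ φ : torsionSubring K k →ₙ+* F × (∀ i, R i),
            Function.Injective φ ∧
            Function.Surjective (fun x => (φ x).1) ∧
            (∀ i, Function.Surjective (fun x => (φ x).2 i)) := by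
  refine ⟨FinSep.exists_subdirect_product_of_finitelySeparable hfg, ?_⟩
  rintro ⟨k, hk, hfgk, F, hF, hFfin, n, R, hR, q, hq, hqR, hdom, hdep, φ, hinj, -, -⟩
  refine FinSep.finitelySeparable_of_family (B := ℤ) (fun n => ⟨n, rfl⟩) (fun b hb => ?_)
    hk.ne_zero hfg ((FinSep.fg_quotient_torsion_iff k).1 hfgk) hq hqR hdom hdep
    ((NonUnitalRingHom.fst F (∀ i, R i)).comp φ)
    (fun i => ((Pi.evalNonUnitalRingHom R i).comp (NonUnitalRingHom.snd F (∀ i, R i))).comp φ)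
    fun x hx hx' => (injective_iff_map_eq_zero φ).1 hinj x (Prod.ext hx (funext hx'))
  exact (smul_eq_zero.1 hb).resolve_left hk.ne_zero
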